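/- Connectedness: For every turn sequence σ, both the reachable set A(σ) and the unreachable set ℤ² \ A(σ) are connected, where S ⊆ ℤ² is called connected if any two points of S can be joined by a path of points of S in which consecutive points are at L¹-distance 1. -/

import Mathlib

/-- A turn: left (`L`) or right (`R`). -/
inductive Turn : Type
  | L : Turn
  | R : Turn
  deriving DecidableEq

/-- Rotation of a direction vector by 90° counterclockwise. -/
def rotCCW (d : ℤ × ℤ) : ℤ × ℤ := (-d.2, d.1)

/-- Rotation of a direction vector by 90° clockwise. -/
def rotCW (d : ℤ × ℤ) : ℤ × ℤ := (d.2, -d.1)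

/-- Unit direction of the axis-parallel segment from `u` to `v`. -/
def unitDir (u v : ℤ × ℤ) : ℤ × ℤ := ((v.1 - u.1).sign, (v.2 - u.2).sign)

/-- The set of integer points on the axis-parallel closed segment from `u` to `v`. -/
def segSet (u v : ℤ × ℤ) : Set (ℤ × ℤ) :=
  {q | min u.1 v.1 ≤ q.1 ∧ q.1 ≤ max u.1 v.1 ∧ min u.2 v.2 ≤ q.2 ∧ q.2 ≤ max u.2 v.2}

/-- A simple rectilinear chain realizing the turn sequence `σ = σ₁⋯σₙ` (as a list,
`σ.get ⟨i, _⟩` is the `(i+1)`-st turn `σ_{i+1}`).  It consists of the points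
`pts 0, …, pts (n+1)` with `pts 0 = (0,0)`; consecutive points span nondegenerate
axis-parallel segments, the first segment heads east, the chain turns left (CCW) or
right (CW) at each bend as prescribed by `σ`, and the chain is simple. -/
structure Chain (σ : List Turn) where
  pts : ℕ → ℤ × ℤ
  start_eq : pts 0 = (0, 0)
  first_seg : ∃ t : ℤ, 0 < t ∧ pts 1 = (t, 0)
  axis_parallel : ∀ i ≤ σ.length,
    ((pts (i + 1)).1 = (pts i).1 ∧ (pts (i + 1)).2 ≠ (pts i).2) ∨
    ((pts (i + 1)).2 = (pts i).2 ∧ (pts (i + 1)).1 ≠ (pts i).1)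
  turns : ∀ i, ∀ h : i < σ.length,
    unitDir (pts (i + 1)) (pts (i + 2)) =
      (if σ.get ⟨i, h⟩ = Turn.L then rotCCW else rotCW) (unitDir (pts i) (pts (i + 1)))
  simple_adj : ∀ i, i + 1 ≤ σ.length →
    segSet (pts i) (pts (i + 1)) ∩ segSet (pts (i + 1)) (pts (i + 2)) = {pts (i + 1)}
  simple_nonadj : ∀ i j, i + 1 < j → j ≤ σ.length →
    segSet (pts i) (pts (i + 1)) ∩ segSet (pts j) (pts (j + 1)) = ∅

/-- `A(σ)`: the set of points reachable by the turn sequence `σ`. -/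
def ReachSet (σ : List Turn) : Set (ℤ × ℤ) :=
  {q | ∃ C : Chain σ, C.pts (σ.length + 1) = q}

/-- The halfplane `V⁺(p)` (requires `p.1 ≠ 0` to be meaningful). -/
def Vplus (p : ℤ × ℤ) : Set (ℤ × ℤ) :=
  {q | ∃ i j : ℤ, 0 ≤ i ∧ q = (p.1 + p.1.sign * i, j)}

/-- The halfplane `H⁺(p)` (requires `p.2 ≠ 0` to be meaningful). -/
def Hplus (p : ℤ × ℤ) : Set (ℤ × ℤ) :=
  {q | ∃ i j : ℤ, 0 ≤ j ∧ q = (i, p.2 + p.2.sign * j)}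

/-- The quadrant `Q⁺(p)`. -/
def Qplus (p : ℤ × ℤ) : Set (ℤ × ℤ) := Vplus p ∩ Hplus p

/-- A staircase: consecutive turns always differ. -/
def IsStaircase (σ : List Turn) : Prop := σ.Chain' (· ≠ ·)

/-- The prefix number `δᵢ`: number of `L`s minus number of `R`s among the first `i` turns. -/
def delta (σ : List Turn) (i : ℕ) : ℤ :=
  ((σ.take i).count Turn.L : ℤ) - ((σ.take i).count Turn.R : ℤ)

/-- The excess number `l - r` of a turn sequence. -/
def excess (σ : List Turn) : ℤ := (σ.count Turn.L : ℤ) - (σ.count Turn.R : ℤ)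

/-- `σ` has a hook (two equal consecutive turns, at 1-based positions `k+1, k+2`)
whose prefix number is `≡ d (mod 4)`: `d = 0, 1, 2, 3` for right, up, left, down hooks. -/
def HasHook (σ : List Turn) (d : ℤ) : Prop :=
  ∃ k, ∃ h : k + 1 < σ.length,
    σ.get ⟨k, by omega⟩ = σ.get ⟨k + 1, h⟩ ∧ delta σ (k + 1) % 4 = d

/-- `σ` has some hook, i.e. two equal consecutive turns. -/
def HasAnyHook (σ : List Turn) : Prop :=
  ∃ k, ∃ h : k + 1 < σ.length, σ.get ⟨k, by omega⟩ = σ.get ⟨k + 1, h⟩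

/-- A set `S ⊆ ℤ²` is connected: any two points of `S` are joined by a path inside `S`
whose consecutive points are at `L¹`-distance `1`. -/
def GridConnected (S : Set (ℤ × ℤ)) : Prop :=
  ∀ p ∈ S, ∀ q ∈ S, ∃ (n : ℕ) (f : ℕ → ℤ × ℤ),
    f 0 = p ∧ f n = q ∧ (∀ i ≤ n, f i ∈ S) ∧
    ∀ i < n, |(f (i + 1)).1 - (f i).1| + |(f (i + 1)).2 - (f i).2| = 1

/-- `q` lies on the boundary of the smallest axis-parallel bounding box of the chain `C`
(for `q` a point of the chain: it attains an extreme coordinate). -/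
def OnBBoxBoundary (σ : List Turn) (C : Chain σ) (q : ℤ × ℤ) : Prop :=
  (∀ i ≤ σ.length + 1, q.1 ≤ (C.pts i).1) ∨ (∀ i ≤ σ.length + 1, (C.pts i).1 ≤ q.1) ∨
  (∀ i ≤ σ.length + 1, q.2 ≤ (C.pts i).2) ∨ (∀ i ≤ σ.length + 1, (C.pts i).2 ≤ q.2)

/-- The last segment of the chain `C` is entirely contained in one side of the smallest
axis-parallel bounding box of `C`. -/
def LastSegOnSide (σ : List Turn) (C : Chain σ) : Prop :=
  ((C.pts σ.length).1 = (C.pts (σ.length + 1)).1 ∧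
     ∀ i ≤ σ.length + 1, (C.pts σ.length).1 ≤ (C.pts i).1) ∨
  ((C.pts σ.length).1 = (C.pts (σ.length + 1)).1 ∧
     ∀ i ≤ σ.length + 1, (C.pts i).1 ≤ (C.pts σ.length).1) ∨
  ((C.pts σ.length).2 = (C.pts (σ.length + 1)).2 ∧
     ∀ i ≤ σ.length + 1, (C.pts σ.length).2 ≤ (C.pts i).2) ∨
  ((C.pts σ.length).2 = (C.pts (σ.length + 1)).2 ∧
     ∀ i ≤ σ.length + 1, (C.pts i).2 ≤ (C.pts σ.length).2)

/-- The turn `σₘ` (1-based indexing). -/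
def turnAt (σ : List Turn) (m : ℕ) : Turn := σ.getD (m - 1) Turn.L

/-- The suffix `σ_k ⋯ σ_n` contains no hook and all its prefix numbers `δᵢ`,
`k - 1 ≤ i ≤ n`, are `≡ 1` or `2 (mod 4)` (the combinatorial description of a
NW-staircase containing the endpoint). -/
def GoodSuffix (σ : List Turn) (k : ℕ) : Prop :=
  1 ≤ k ∧ k ≤ σ.length ∧
  (∀ m : ℕ, k ≤ m → m < σ.length → turnAt σ m ≠ turnAt σ (m + 1)) ∧
  (∀ i : ℕ, k - 1 ≤ i → i ≤ σ.length → delta σ i % 4 = 1 ∨ delta σ i % 4 = 2)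

open Classical in
/-- `₋ₓm₊ᵧᵖ(σ)`: taking the longest good suffix (i.e. the least `k` with
`GoodSuffix σ k`), the number of indices `i` with `k - 1 ≤ i ≤ n` and
`δᵢ ≡ 1 (mod 4)`; `0` if no good suffix exists. -/
noncomputable def mNWp (σ : List Turn) : ℕ :=
  if ∃ k, GoodSuffix σ k then
    Nat.card {i : ℕ // sInf {k | GoodSuffix σ k} - 1 ≤ i ∧ i ≤ σ.length ∧
      delta σ i % 4 = 1}
  else 0

/-- The number of vertical segments of the chain `C` meeting the closed horizontal
segment from the origin to `(a, 0)`. -/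
def verticalCrossCount (σ : List Turn) (C : Chain σ) (a : ℤ) : ℕ :=
  ((Finset.range (σ.length + 1)).filter fun i =>
    (C.pts i).1 = (C.pts (i + 1)).1 ∧
    0 ≤ (C.pts i).1 ∧ (C.pts i).1 ≤ a ∧
    min (C.pts i).2 (C.pts (i + 1)).2 ≤ 0 ∧ 0 ≤ max (C.pts i).2 (C.pts (i + 1)).2).card

/-- The unit direction of the `(i+1)`-st segment of the chain `C`. -/
def dirOf (σ : List Turn) (C : Chain σ) (i : ℕ) : ℤ × ℤ := unitDir (C.pts i) (C.pts (i + 1))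

/-- `z₁mz₂ᵒ(C)`: the number of `z₂`-segments in the maximal `(z₁,z₂)`-staircase subchain
of `C` containing the origin (the longest prefix of segments directed `z₁` or `z₂`);
`0` if no such subchain exists. -/
noncomputable def stairCountO (σ : List Turn) (C : Chain σ) (z₁ z₂ : ℤ × ℤ) : ℕ :=
  Nat.card {i : ℕ // i ≤ σ.length ∧ dirOf σ C i = z₂ ∧
    ∀ j ≤ i, dirOf σ C j = z₁ ∨ dirOf σ C j = z₂}

/-- `z₁mz₂ᵖ(C)`: the number of `z₂`-segments in the maximal `(z₁,z₂)`-staircase subchain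
of `C` containing the endpoint (the longest suffix of segments directed `z₁` or `z₂`);
`0` if no such subchain exists. -/
noncomputable def stairCountP (σ : List Turn) (C : Chain σ) (z₁ z₂ : ℤ × ℤ) : ℕ :=
  Nat.card {i : ℕ // i ≤ σ.length ∧ dirOf σ C i = z₂ ∧
    ∀ j, i ≤ j → j ≤ σ.length → dirOf σ C j = z₁ ∨ dirOf σ C j = z₂}

/-! ### Chains with prescribed segment directions -/

/-- An alternating sequence of axis-parallel unit vectors. -/
structure IsDirSeq (d : ℕ → ℤ × ℤ) : Prop where
  unit : ∀ i, d i = (1, 0) ∨ d i = (-1, 0) ∨ d i = (0, 1) ∨ d i = (0, -1)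
  perp : ∀ i, (d i).1 = 0 ↔ (d (i + 1)).1 ≠ 0

/-- The polyline `p 0, …, p (n + 1)` starts at the origin, its `i`-th segment points in direction
`d i`, and nonadjacent segments are disjoint. -/
structure Realizes (n : ℕ) (d p : ℕ → ℤ × ℤ) : Prop where
  zero : p 0 = (0, 0)
  step : ∀ i ≤ n, ∃ t : ℤ, 0 < t ∧ (p (i + 1)).1 = (p i).1 + t * (d i).1 ∧
    (p (i + 1)).2 = (p i).2 + t * (d i).2
  disj : ∀ i j, i + 1 < j → j ≤ n → ∀ z, z ∈ segSet (p i) (p (i + 1)) →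
    z ∉ segSet (p j) (p (j + 1))

/-- The points reachable with `n + 1` segments in the directions `d`. -/
def reach (n : ℕ) (d : ℕ → ℤ × ℤ) : Set (ℤ × ℤ) := {z | ∃ p, Realizes n d p ∧ p (n + 1) = z}

lemma mem_segSet {u v z : ℤ × ℤ} : z ∈ segSet u v ↔
    min u.1 v.1 ≤ z.1 ∧ z.1 ≤ max u.1 v.1 ∧ min u.2 v.2 ≤ z.2 ∧ z.2 ≤ max u.2 v.2 := Iff.rfl

lemma left_mem_segSet (u v : ℤ × ℤ) : u ∈ segSet u v := by rw [mem_segSet]; omega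

lemma right_mem_segSet (u v : ℤ × ℤ) : v ∈ segSet u v := by rw [mem_segSet]; omega

section Realizes

variable {n : ℕ} {d p : ℕ → ℤ × ℤ}

lemma Realizes.step_cases (hd : IsDirSeq d) (h : Realizes n d p) {i : ℕ} (hi : i ≤ n) :
    (d i = (1, 0) ∧ (p (i + 1)).2 = (p i).2 ∧ (p i).1 < (p (i + 1)).1) ∨
    (d i = (-1, 0) ∧ (p (i + 1)).2 = (p i).2 ∧ (p (i + 1)).1 < (p i).1) ∨
    (d i = (0, 1) ∧ (p (i + 1)).1 = (p i).1 ∧ (p i).2 < (p (i + 1)).2) ∨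
    (d i = (0, -1) ∧ (p (i + 1)).1 = (p i).1 ∧ (p (i + 1)).2 < (p i).2) := by
  obtain ⟨t, ht, h1, h2⟩ := h.step i hi
  rcases hd.unit i with e | e | e | e <;> simp only [e] at h1 h2 ⊢ <;> simp <;> omega

lemma IsDirSeq.perp_cases (hd : IsDirSeq d) (i : ℕ) :
    ((d i = (1, 0) ∨ d i = (-1, 0)) ∧ (d (i + 1) = (0, 1) ∨ d (i + 1) = (0, -1))) ∨
    ((d i = (0, 1) ∨ d i = (0, -1)) ∧ (d (i + 1) = (1, 0) ∨ d (i + 1) = (-1, 0))) := by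
  have := hd.perp i
  rcases hd.unit i with e | e | e | e <;> rcases hd.unit (i + 1) with f | f | f | f <;>
    simp [e, f] at this ⊢

lemma Realizes.eq_of_mem_of_mem_succ (hd : IsDirSeq d) (h : Realizes n d p) {i : ℕ}
    (hi : i + 1 ≤ n) {z : ℤ × ℤ} (h1 : z ∈ segSet (p i) (p (i + 1)))
    (h2 : z ∈ segSet (p (i + 1)) (p (i + 1 + 1))) : z = p (i + 1) := by
  rw [mem_segSet] at h1 h2
  have a := h.step_cases hd (show i ≤ n by omega)
  have b := h.step_cases hd hi
  apply Prod.ext <;>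
  rcases hd.perp_cases i with ⟨e | e, f | f⟩ | ⟨e | e, f | f⟩ <;> simp [e, f] at a b <;> omega

/-- Two distinct segments of a simple chain only meet at a common vertex. -/
lemma Realizes.eq_of_mem_of_mem (hd : IsDirSeq d) (h : Realizes n d p) {i j : ℕ}
    (hij : i < j) (hj : j ≤ n) {z : ℤ × ℤ} (h1 : z ∈ segSet (p i) (p (i + 1)))
    (h2 : z ∈ segSet (p j) (p (j + 1))) : j = i + 1 ∧ z = p j := by
  have : j = i + 1 := by
    by_contra hne
    exact h.disj i j (by omega) hj z h1 h2
  subst this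
  exact ⟨rfl, h.eq_of_mem_of_mem_succ hd hj h1 h2⟩

lemma Realizes.index_eq_of_last_mem (hd : IsDirSeq d) (h : Realizes n d p) {i : ℕ} (hi : i ≤ n)
    (h1 : p (n + 1) ∈ segSet (p i) (p (i + 1))) : i = n := by
  by_contra hne
  obtain ⟨-, e⟩ := h.eq_of_mem_of_mem hd (show i < n by omega) le_rfl h1 (right_mem_segSet _ _)
  have := h.step_cases hd le_rfl
  rw [e] at this
  omega

lemma Realizes.index_eq_zero_of_mem (hd : IsDirSeq d) (h : Realizes n d p) {i : ℕ} (hi : i ≤ n)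
    (h1 : p 0 ∈ segSet (p i) (p (i + 1))) : i = 0 := by
  by_contra hne
  obtain ⟨rfl, e⟩ := h.eq_of_mem_of_mem hd (show 0 < i by omega) hi (left_mem_segSet _ _) h1
  have := h.step_cases hd (Nat.zero_le n)
  rw [e] at this
  omega

lemma zero_notMem_reach (hd : IsDirSeq d) : ((0, 0) : ℤ × ℤ) ∉ reach n d := by
  rintro ⟨p, h, e⟩
  have h0 := h.index_eq_of_last_mem hd (Nat.zero_le n)
    (by rw [e, ← h.zero]; exact left_mem_segSet _ _)
  subst h0
  have := h.step_cases hd le_rfl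
  rw [h.zero, zero_add] at this
  rw [zero_add] at e
  simp [e] at this

/-! ### Horizontal and vertical comparability -/

/-- The unit edge from `z` to its eastern neighbour is covered by the chain. -/
def HArm (n : ℕ) (p : ℕ → ℤ × ℤ) (z : ℤ × ℤ) : Prop :=
  ∃ i ≤ n, z ∈ segSet (p i) (p (i + 1)) ∧ (z.1 + 1, z.2) ∈ segSet (p i) (p (i + 1))

/-- The unit edge from `z` to its northern neighbour is covered by the chain. -/
def VArm (n : ℕ) (p : ℕ → ℤ × ℤ) (z : ℤ × ℤ) : Prop :=
  ∃ i ≤ n, z ∈ segSet (p i) (p (i + 1)) ∧ (z.1, z.2 + 1) ∈ segSet (p i) (p (i + 1))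

/-- `b` can be reached from `a` by arbitrary unit steps east and by vertical unit steps along the
chain: if `a` is pushed to the east, then `b` has to give way. -/
inductive ReachR (n : ℕ) (p : ℕ → ℤ × ℤ) (a : ℤ × ℤ) : ℤ × ℤ → Prop
  | refl : ReachR n p a a
  | east {b : ℤ × ℤ} : ReachR n p a b → ReachR n p a (b.1 + 1, b.2)
  | north {b : ℤ × ℤ} : ReachR n p a b → VArm n p b → ReachR n p a (b.1, b.2 + 1)
  | south {b : ℤ × ℤ} : ReachR n p a (b.1, b.2 + 1) → VArm n p b → ReachR n p a b

/-- The analogue of `ReachR` with arbitrary unit steps north and horizontal steps along the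
chain. -/
def ReachU (n : ℕ) (p : ℕ → ℤ × ℤ) (a b : ℤ × ℤ) : Prop :=
  ReachR n (fun i => (p i).swap) a.swap b.swap

lemma ReachR.trans {a b c : ℤ × ℤ} (h1 : ReachR n p a b) (h2 : ReachR n p b c) :
    ReachR n p a c := by
  induction h2 with
  | refl => exact h1
  | east _ ih => exact ih.east
  | north _ hv ih => exact ih.north hv
  | south _ hv ih => exact ih.south hv

lemma swap_mem_segSet {u v z : ℤ × ℤ} : z.swap ∈ segSet u.swap v.swap ↔ z ∈ segSet u v := by
  simp only [mem_segSet, Prod.fst_swap, Prod.snd_swap]; tauto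

lemma vArm_swap {z : ℤ × ℤ} : VArm n (fun i => (p i).swap) z.swap ↔ HArm n p z :=
  exists_congr fun _ => and_congr_right fun _ => and_congr swap_mem_segSet
    (swap_mem_segSet (z := (z.1 + 1, z.2)))

lemma ReachU.induction {a b : ℤ × ℤ} {K : ℤ × ℤ → Prop} (h : ReachU n p a b) (ha : K a)
    (north : ∀ z, K z → K (z.1, z.2 + 1))
    (east : ∀ z, HArm n p z → K z → K (z.1 + 1, z.2))
    (west : ∀ z, HArm n p z → K (z.1 + 1, z.2) → K z) : K b := by
  have key : ∀ w, ReachR n (fun i => (p i).swap) a.swap w → K w.swap := by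
    intro w hw
    induction hw with
    | refl => simpa using ha
    | east _ ih => exact north _ ih
    | @north b _ hv ih => exact east b.swap (vArm_swap.1 (by simpa using hv)) ih
    | @south b _ hv ih => exact west b.swap (vArm_swap.1 (by simpa using hv)) ih
  simpa using key _ h

lemma ReachR.le {a b : ℤ × ℤ} (h : ReachR n p a b) : a.1 ≤ b.1 := by
  induction h with
  | refl => exact le_rfl
  | _ => grind

lemma ReachR.of_le {a b : ℤ × ℤ} (h2 : a.2 = b.2) (h1 : a.1 ≤ b.1) : ReachR n p a b := by
  have key : ∀ k : ℕ, ReachR n p a (a.1 + k, a.2) := by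
    intro k
    induction k with
    | zero => simpa using ReachR.refl
    | succ k ih => simpa [add_assoc] using ih.east
  have := key (b.1 - a.1).toNat
  rwa [Int.toNat_of_nonneg (by omega), add_sub_cancel, h2] at this

lemma ReachR.of_mem_vertical {i : ℕ} (hi : i ≤ n) (hv : (p (i + 1)).1 = (p i).1)
    {a b : ℤ × ℤ} (ha : a ∈ segSet (p i) (p (i + 1))) (hb : b ∈ segSet (p i) (p (i + 1))) :
    ReachR n p a b := by
  rw [mem_segSet] at ha hb
  have e : b.1 = a.1 := by omega
  have up : ∀ k : ℕ, a.2 + k ≤ max (p i).2 (p (i + 1)).2 → ReachR n p a (a.1, a.2 + k) := by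
    intro k
    induction k with
    | zero => intro _; simpa using ReachR.refl
    | succ k ih =>
      intro hk
      push_cast at hk
      have := (ih (by omega)).north ⟨i, hi, by rw [mem_segSet]; dsimp only; omega,
        by rw [mem_segSet]; dsimp only; omega⟩
      simpa [add_assoc] using this
  have down : ∀ k : ℕ, min (p i).2 (p (i + 1)).2 ≤ a.2 - k → ReachR n p a (a.1, a.2 - k) := by
    intro k
    induction k with
    | zero => intro _; simpa using ReachR.refl
    | succ k ih =>
      intro hk
      push_cast at hk
      refine ReachR.south (b := (a.1, a.2 - (k + 1 : ℕ))) ?_ ⟨i, hi, ?_, ?_⟩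
      · convert ih (by omega) using 2
        push_cast; ring
      · rw [mem_segSet]; push_cast; omega
      · rw [mem_segSet]; push_cast; omega
  rcases le_total a.2 b.2 with hle | hle
  · have := up (b.2 - a.2).toNat (by omega)
    rw [Int.toNat_of_nonneg (by omega), add_sub_cancel, ← e] at this
    exact this
  · have := down (a.2 - b.2).toNat (by omega)
    rw [Int.toNat_of_nonneg (by omega), sub_sub_cancel, ← e] at this
    exact this

end Realizes

/-! ### Symmetries -/

/-- Reflection in the vertical axis. -/
def reflX (z : ℤ × ℤ) : ℤ × ℤ := (-z.1, z.2)

/-- Reflection in the horizontal axis. -/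
def reflY (z : ℤ × ℤ) : ℤ × ℤ := (z.1, -z.2)

@[simp] lemma reflX_fst (z : ℤ × ℤ) : (reflX z).1 = -z.1 := rfl

@[simp] lemma reflX_snd (z : ℤ × ℤ) : (reflX z).2 = z.2 := rfl

@[simp] lemma reflY_fst (z : ℤ × ℤ) : (reflY z).1 = z.1 := rfl

@[simp] lemma reflY_snd (z : ℤ × ℤ) : (reflY z).2 = -z.2 := rfl

@[simp] lemma reflX_reflX (z : ℤ × ℤ) : reflX (reflX z) = z := by ext <;> simp

@[simp] lemma reflY_reflY (z : ℤ × ℤ) : reflY (reflY z) = z := by ext <;> simp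

lemma reflX_mem_segSet {u v z : ℤ × ℤ} :
    reflX z ∈ segSet (reflX u) (reflX v) ↔ z ∈ segSet u v := by
  simp only [mem_segSet, reflX_fst, reflX_snd]; omega

lemma reflY_mem_segSet {u v z : ℤ × ℤ} :
    reflY z ∈ segSet (reflY u) (reflY v) ↔ z ∈ segSet u v := by
  simp only [mem_segSet, reflY_fst, reflY_snd]; omega

section Symmetry

variable {n : ℕ} {d p : ℕ → ℤ × ℤ}

lemma IsDirSeq.swap (hd : IsDirSeq d) : IsDirSeq fun i => (d i).swap where
  unit i := by rcases hd.unit i with e | e | e | e <;> simp [e]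
  perp i := by
    rcases hd.perp_cases i with ⟨e | e, f | f⟩ | ⟨e | e, f | f⟩ <;> simp [e, f]

lemma IsDirSeq.reflectX (hd : IsDirSeq d) : IsDirSeq fun i => reflX (d i) where
  unit i := by rcases hd.unit i with e | e | e | e <;> simp [e, reflX]
  perp i := by simpa using hd.perp i

lemma IsDirSeq.reflectY (hd : IsDirSeq d) : IsDirSeq fun i => reflY (d i) where
  unit i := by rcases hd.unit i with e | e | e | e <;> simp [e, reflY]
  perp i := by simpa using hd.perp i

lemma Realizes.swap (h : Realizes n d p) :
    Realizes n (fun i => (d i).swap) fun i => (p i).swap where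
  zero := by simp [h.zero]
  step i hi := by
    obtain ⟨t, ht, h1, h2⟩ := h.step i hi
    exact ⟨t, ht, h2, h1⟩
  disj i j hij hj z h1 h2 := by
    rw [← z.swap_swap, swap_mem_segSet] at h1 h2
    exact h.disj i j hij hj _ h1 h2

lemma Realizes.reflectX (h : Realizes n d p) :
    Realizes n (fun i => reflX (d i)) fun i => reflX (p i) where
  zero := by simp [h.zero, reflX]
  step i hi := by
    obtain ⟨t, ht, h1, h2⟩ := h.step i hi
    exact ⟨t, ht, by simp only [reflX_fst]; linarith, h2⟩
  disj i j hij hj z h1 h2 := by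
    rw [← reflX_reflX z, reflX_mem_segSet] at h1 h2
    exact h.disj i j hij hj _ h1 h2

lemma Realizes.reflectY (h : Realizes n d p) :
    Realizes n (fun i => reflY (d i)) fun i => reflY (p i) where
  zero := by simp [h.zero, reflY]
  step i hi := by
    obtain ⟨t, ht, h1, h2⟩ := h.step i hi
    exact ⟨t, ht, h1, by simp only [reflY_snd]; linarith⟩
  disj i j hij hj z h1 h2 := by
    rw [← reflY_reflY z, reflY_mem_segSet] at h1 h2
    exact h.disj i j hij hj _ h1 h2

lemma swap_mem_reach {z : ℤ × ℤ} (hz : z ∈ reach n d) :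
    z.swap ∈ reach n fun i => (d i).swap := by
  obtain ⟨p, h, rfl⟩ := hz
  exact ⟨_, h.swap, rfl⟩

lemma reflX_mem_reach {z : ℤ × ℤ} (hz : z ∈ reach n d) :
    reflX z ∈ reach n fun i => reflX (d i) := by
  obtain ⟨p, h, rfl⟩ := hz
  exact ⟨_, h.reflectX, rfl⟩

lemma reflY_mem_reach {z : ℤ × ℤ} (hz : z ∈ reach n d) :
    reflY z ∈ reach n fun i => reflY (d i) := by
  obtain ⟨p, h, rfl⟩ := hz
  exact ⟨_, h.reflectY, rfl⟩

lemma mem_reach_of_swap {z : ℤ × ℤ} (hz : z.swap ∈ reach n fun i => (d i).swap) :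
    z ∈ reach n d := by
  simpa using swap_mem_reach hz

lemma mem_reach_of_reflX {z : ℤ × ℤ} (hz : reflX z ∈ reach n fun i => reflX (d i)) :
    z ∈ reach n d := by
  simpa using reflX_mem_reach hz

lemma VArm.of_reflX {z : ℤ × ℤ} (h : VArm n (fun i => reflX (p i)) z) : VArm n p (reflX z) := by
  obtain ⟨i, hi, h1, h2⟩ := h
  refine ⟨i, hi, ?_, ?_⟩ <;> rw [← reflX_mem_segSet]
  · simpa using h1
  · simpa [reflX] using h2

lemma VArm.of_reflY {z : ℤ × ℤ} (h : VArm n (fun i => reflY (p i)) (z.1, z.2)) :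
    VArm n p (z.1, -(z.2 + 1)) := by
  obtain ⟨i, hi, h1, h2⟩ := h
  refine ⟨i, hi, ?_, ?_⟩ <;> rw [← reflY_mem_segSet]
  · simpa [reflY] using h2
  · simpa [reflY] using h1

lemma ReachR.of_reflX {a b : ℤ × ℤ} (h : ReachR n (fun i => reflX (p i)) a b) :
    ReachR n p (reflX b) (reflX a) := by
  induction h with
  | refl => exact .refl
  | @east b _ ih => exact (ReachR.of_le (by simp) (by simp)).trans ih
  | @north b _ hv ih => exact (ReachR.south (b := reflX b) .refl hv.of_reflX).trans ih
  | @south b _ hv ih => exact (ReachR.refl.north hv.of_reflX).trans ih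

lemma ReachR.of_reflY {a b : ℤ × ℤ} (h : ReachR n (fun i => reflY (p i)) a b) :
    ReachR n p (reflY a) (reflY b) := by
  induction h with
  | refl => exact .refl
  | @east b _ ih => exact ih.east
  | @north b _ hv ih =>
    refine ReachR.south (b := (b.1, -(b.2 + 1))) ?_ hv.of_reflY
    simpa [reflY] using ih
  | @south b _ hv ih =>
    have := ih.north hv.of_reflY
    simpa [reflY] using this

lemma ReachU.of_reflY {a b : ℤ × ℤ} (h : ReachU n (fun i => reflY (p i)) a b) :
    ReachU n p (reflY b) (reflY a) := ReachR.of_reflX (p := fun i => (p i).swap) h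

lemma ReachU.of_reflX {a b : ℤ × ℤ} (h : ReachU n (fun i => reflX (p i)) a b) :
    ReachU n p (reflX a) (reflX b) := ReachR.of_reflY (p := fun i => (p i).swap) h

end Symmetry

/-! ### Pushing the endpoint -/

section Shift

variable {n : ℕ} {d p : ℕ → ℤ × ℤ}

open Classical in
/-- Translate by `k` to the east everything that gives way when the endpoint is pushed east. -/
noncomputable def shiftR (n : ℕ) (p : ℕ → ℤ × ℤ) (k : ℤ) (z : ℤ × ℤ) : ℤ × ℤ :=
  (z.1 + if ReachR n p (p (n + 1)) z then k else 0, z.2)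

lemma shiftR_of_reachR {k : ℤ} {z : ℤ × ℤ} (h : ReachR n p (p (n + 1)) z) :
    shiftR n p k z = (z.1 + k, z.2) := by simp [shiftR, h]

lemma shiftR_of_not_reachR {k : ℤ} {z : ℤ × ℤ} (h : ¬ ReachR n p (p (n + 1)) z) :
    shiftR n p k z = z := by simp [shiftR, h]

@[simp] lemma shiftR_snd {k : ℤ} {z : ℤ × ℤ} : (shiftR n p k z).2 = z.2 := rfl

lemma shiftR_sub_le {k : ℤ} (hk : 0 ≤ k) {u v : ℤ × ℤ} (h2 : u.2 = v.2) (h1 : u.1 ≤ v.1) :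
    v.1 - u.1 ≤ (shiftR n p k v).1 - (shiftR n p k u).1 := by
  by_cases hu : ReachR n p (p (n + 1)) u
  · rw [shiftR_of_reachR hu, shiftR_of_reachR (hu.trans (.of_le h2 h1))]
    dsimp only; omega
  · rw [shiftR_of_not_reachR hu]
    by_cases hv : ReachR n p (p (n + 1)) v
    · rw [shiftR_of_reachR hv]; dsimp only; omega
    · rw [shiftR_of_not_reachR hv]

lemma shiftR_fst_of_vertical {k : ℤ} {i : ℕ} (hi : i ≤ n) (hv : (p (i + 1)).1 = (p i).1)
    {u v : ℤ × ℤ} (hu : u ∈ segSet (p i) (p (i + 1))) (hw : v ∈ segSet (p i) (p (i + 1))) :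
    (shiftR n p k u).1 = (shiftR n p k v).1 := by
  have e : u.1 = v.1 := by rw [mem_segSet] at hu hw; omega
  by_cases h : ReachR n p (p (n + 1)) u
  · rw [shiftR_of_reachR h, shiftR_of_reachR (h.trans (.of_mem_vertical hi hv hu hw)), e]
  · rw [shiftR_of_not_reachR h,
      shiftR_of_not_reachR fun h' => h (h'.trans (.of_mem_vertical hi hv hw hu)), e]

/-- A point of a shifted segment lies between the shifts of the ends of a horizontal slice of the
original segment. -/
lemma Realizes.exists_slice (hd : IsDirSeq d) (h : Realizes n d p) (k : ℤ) {i : ℕ}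
    (hi : i ≤ n) {z : ℤ × ℤ}
    (hz : z ∈ segSet (shiftR n p k (p i)) (shiftR n p k (p (i + 1)))) (hk : 0 ≤ k) :
    ∃ u ∈ segSet (p i) (p (i + 1)), ∃ v ∈ segSet (p i) (p (i + 1)), u.2 = z.2 ∧ v.2 = z.2 ∧
      u.1 ≤ v.1 ∧ (shiftR n p k u).1 ≤ z.1 ∧ z.1 ≤ (shiftR n p k v).1 := by
  rw [mem_segSet] at hz
  simp only [shiftR_snd] at hz
  have hor : ∀ u v : ℤ × ℤ, u.2 = v.2 → u.1 ≤ v.1 → (shiftR n p k u).1 ≤ (shiftR n p k v).1 :=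
    fun u v h2 h1 => by have := shiftR_sub_le (n := n) (p := p) hk h2 h1; omega
  have ver : (p (i + 1)).1 = (p i).1 → ∃ u ∈ segSet (p i) (p (i + 1)),
      ∃ v ∈ segSet (p i) (p (i + 1)), u.2 = z.2 ∧ v.2 = z.2 ∧
      u.1 ≤ v.1 ∧ (shiftR n p k u).1 ≤ z.1 ∧ z.1 ≤ (shiftR n p k v).1 := by
    intro hv
    have hm : ((p i).1, z.2) ∈ segSet (p i) (p (i + 1)) := by rw [mem_segSet]; dsimp only; omega
    have e1 := shiftR_fst_of_vertical (k := k) hi hv hm (left_mem_segSet _ _)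
    have e2 := shiftR_fst_of_vertical (k := k) hi hv hm (right_mem_segSet _ _)
    exact ⟨_, hm, _, hm, rfl, rfl, le_rfl, by omega, by omega⟩
  rcases h.step_cases hd hi with ⟨-, h2, h1⟩ | ⟨-, h2, h1⟩ | ⟨-, h1, h2⟩ | ⟨-, h1, h2⟩
  · clear ver
    have := hor _ _ h2.symm h1.le
    exact ⟨_, left_mem_segSet _ _, _, right_mem_segSet _ _, by omega, by omega, h1.le, by omega,
      by omega⟩
  · clear ver
    have := hor _ _ h2 h1.le
    exact ⟨_, right_mem_segSet _ _, _, left_mem_segSet _ _, by omega, by omega, h1.le, by omega,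
      by omega⟩
  · exact ver h1
  · exact ver h1

lemma Realizes.shift (hd : IsDirSeq d) (h : Realizes n d p) (h0 : ¬ ReachR n p (p (n + 1)) (0, 0))
    {k : ℤ} (hk : 0 ≤ k) : Realizes n d fun i => shiftR n p k (p i) where
  zero := by rw [h.zero, shiftR_of_not_reachR h0]
  step i hi := by
    have ver := shiftR_fst_of_vertical (n := n) (p := p) (k := k) hi
    rcases h.step_cases hd hi with ⟨e, h2, h1⟩ | ⟨e, h2, h1⟩ | ⟨e, h1, h2⟩ | ⟨e, h1, h2⟩
    · have := shiftR_sub_le (n := n) (p := p) hk h2.symm h1.le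
      exact ⟨(shiftR n p k (p (i + 1))).1 - (shiftR n p k (p i)).1, by omega,
        by simp [e], by simp [e, h2]⟩
    · have := shiftR_sub_le (n := n) (p := p) hk h2 h1.le
      exact ⟨(shiftR n p k (p i)).1 - (shiftR n p k (p (i + 1))).1, by omega,
        by simp [e], by simp [e, h2]⟩
    · exact ⟨(p (i + 1)).2 - (p i).2, by omega,
        by simp [e, ver h1 (left_mem_segSet _ _) (right_mem_segSet _ _)], by simp [e]⟩
    · exact ⟨(p i).2 - (p (i + 1)).2, by omega,
        by simp [e, ver h1 (left_mem_segSet _ _) (right_mem_segSet _ _)], by simp [e]⟩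
  disj i j hij hj z hzi hzj := by
    obtain ⟨u, hu, v, hv, hu2, hv2, huv, hu1, hv1⟩ := h.exists_slice hd k (by omega) hzi hk
    obtain ⟨u', hu', v', hv', hu2', hv2', huv', hu1', hv1'⟩ := h.exists_slice hd k hj hzj hk
    by_cases c1 : v.1 < u'.1
    · have := shiftR_sub_le (n := n) (p := p) hk (hv2.trans hu2'.symm) c1.le
      omega
    by_cases c2 : v'.1 < u.1
    · have := shiftR_sub_le (n := n) (p := p) hk (hv2'.trans hu2.symm) c2.le
      omega
    refine h.disj i j hij hj (max u.1 u'.1, z.2) ?_ ?_ <;> rw [mem_segSet] at * <;>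
      dsimp only <;> omega

/-- If pushing the endpoint east does not move the origin, the endpoint may be pushed east. -/
lemma Realizes.mem_reach_east (hd : IsDirSeq d) (h : Realizes n d p)
    (h0 : ¬ ReachR n p (p (n + 1)) (0, 0)) {x : ℤ} (hx : (p (n + 1)).1 ≤ x) :
    (x, (p (n + 1)).2) ∈ reach n d := by
  refine ⟨_, h.shift hd h0 (sub_nonneg.2 hx), ?_⟩
  rw [shiftR_of_reachR .refl, add_sub_cancel]

lemma Realizes.mem_reach_west (hd : IsDirSeq d) (h : Realizes n d p)
    (h0 : ¬ ReachR n p (0, 0) (p (n + 1))) {x : ℤ} (hx : x ≤ (p (n + 1)).1) :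
    (x, (p (n + 1)).2) ∈ reach n d := by
  apply mem_reach_of_reflX
  refine h.reflectX.mem_reach_east hd.reflectX (fun hr => h0 ?_) (x := -x) (by simpa using hx)
  simpa [reflX] using hr.of_reflX

/-- Every point in row `y` is reachable. -/
def FullRow (n : ℕ) (d : ℕ → ℤ × ℤ) (y : ℤ) : Prop := ∀ x, (x, y) ∈ reach n d

/-- Every point in column `x` is reachable. -/
def FullCol (n : ℕ) (d : ℕ → ℤ × ℤ) (x : ℤ) : Prop := ∀ y, (x, y) ∈ reach n d

lemma fullRow_swap {y : ℤ} : FullRow n (fun i => (d i).swap) y ↔ FullCol n d y :=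
  ⟨fun h x => mem_reach_of_swap (h x), fun h x => swap_mem_reach (h x)⟩

lemma fullCol_swap {x : ℤ} : FullCol n (fun i => (d i).swap) x ↔ FullRow n d x :=
  ⟨fun h y => mem_reach_of_swap (h y), fun h y => swap_mem_reach (h y)⟩

lemma Realizes.fullRow (hd : IsDirSeq d) (h : Realizes n d p)
    (h1 : ¬ ReachR n p (p (n + 1)) (0, 0)) (h2 : ¬ ReachR n p (0, 0) (p (n + 1))) :
    FullRow n d (p (n + 1)).2 := fun x =>
  (le_total (p (n + 1)).1 x).elim (h.mem_reach_east hd h1) (h.mem_reach_west hd h2)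

lemma Realizes.fullCol (hd : IsDirSeq d) (h : Realizes n d p)
    (h1 : ¬ ReachU n p (p (n + 1)) (0, 0)) (h2 : ¬ ReachU n p (0, 0) (p (n + 1))) :
    FullCol n d (p (n + 1)).1 :=
  fullRow_swap.1 (h.swap.fullRow hd.swap h1 h2)

/-- The reachable set is closed under moving away from the vertical axis. -/
lemma mem_reach_of_outward (hd : IsDirSeq d) {x x' y : ℤ} (h : (x, y) ∈ reach n d)
    (hx : (0 < x ∧ x ≤ x') ∨ (x < 0 ∧ x' ≤ x)) : (x', y) ∈ reach n d := by
  obtain ⟨p, hp, e⟩ := h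
  have key1 := hp.mem_reach_east hd (x := x')
  have key2 := hp.mem_reach_west hd (x := x')
  rw [e] at key1 key2
  rcases hx with ⟨h1, h2⟩ | ⟨h1, h2⟩
  · exact key1 (fun hr => by have := hr.le; dsimp only at this; omega) h2
  · exact key2 (fun hr => by have := hr.le; dsimp only at this; omega) h2

lemma mem_reach_of_outward_vertical (hd : IsDirSeq d) {x y y' : ℤ} (h : (x, y) ∈ reach n d)
    (hy : (0 < y ∧ y ≤ y') ∨ (y < 0 ∧ y' ≤ y)) : (x, y') ∈ reach n d :=
  mem_reach_of_swap (mem_reach_of_outward hd.swap (y := x) (swap_mem_reach h) hy)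

lemma FullCol.outward (hd : IsDirSeq d) {x x' : ℤ} (h : FullCol n d x)
    (hx : (0 < x ∧ x ≤ x') ∨ (x < 0 ∧ x' ≤ x)) : FullCol n d x' :=
  fun y => mem_reach_of_outward hd (h y) hx

lemma FullRow.outward (hd : IsDirSeq d) {y y' : ℤ} (h : FullRow n d y)
    (hy : (0 < y ∧ y ≤ y') ∨ (y < 0 ∧ y' ≤ y)) : FullRow n d y' :=
  fun x => mem_reach_of_outward_vertical hd (h x) hy

end Shift

/-! ### Endpoints that push the origin in two directions -/

section Staircase

variable {n : ℕ} {d p : ℕ → ℤ × ℤ}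

/-- `z` lies on the initial part of the chain consisting of segments heading east or north, with
the convention that a bend belongs to the segment ending there. -/
def OnInitial (n : ℕ) (d p : ℕ → ℤ × ℤ) (z : ℤ × ℤ) : Prop :=
  ∃ i ≤ n, z ∈ segSet (p i) (p (i + 1)) ∧ (∀ j ≤ i, d j = (1, 0) ∨ d j = (0, 1)) ∧
    (z = p i → i = 0)

/-- The chain leaves `z` both to the west and to the south. -/
def OnCorner (n : ℕ) (p : ℕ → ℤ × ℤ) (z : ℤ × ℤ) : Prop :=
  HArm n p (z.1 - 1, z.2) ∧ VArm n p (z.1, z.2 - 1)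

lemma Realizes.vertex_of_mem_of_mem (hd : IsDirSeq d) (h : Realizes n d p) {i j : ℕ} (hi : i ≤ n)
    (hj : j ≤ n) (hij : i ≠ j) {z : ℤ × ℤ} (h1 : z ∈ segSet (p i) (p (i + 1)))
    (h2 : z ∈ segSet (p j) (p (j + 1))) :
    (j = i + 1 ∧ z = p j ∧ z = p (i + 1)) ∨ (i = j + 1 ∧ z = p i ∧ z = p (j + 1)) := by
  rcases lt_or_gt_of_ne hij with hlt | hlt
  · obtain ⟨rfl, e⟩ := h.eq_of_mem_of_mem hd hlt hj h1 h2
    exact Or.inl ⟨rfl, e, e⟩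
  · obtain ⟨rfl, e⟩ := h.eq_of_mem_of_mem hd hlt hi h2 h1
    exact Or.inr ⟨rfl, e, e⟩

lemma OnInitial.of_arm (hd : IsDirSeq d) (h : Realizes n d p) {z w : ℤ × ℤ}
    (hz : OnInitial n d p z) {j : ℕ} (hj : j ≤ n) (h1 : z ∈ segSet (p j) (p (j + 1)))
    (h2 : w ∈ segSet (p j) (p (j + 1))) (hw : w = (z.1 + 1, z.2) ∨ w = (z.1, z.2 + 1)) :
    OnInitial n d p w := by
  obtain ⟨i, hi, hzi, hdir, hstart⟩ := hz
  have c := h.step_cases hd hj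
  by_cases hij : i = j
  · subst hij
    refine ⟨i, hi, h2, hdir, fun e => ?_⟩
    rw [mem_segSet] at h1 h2
    rw [← e] at c h1 h2
    rcases hdir i le_rfl with f | f <;> rcases hw with rfl | rfl <;> simp [f] at c h1 h2 <;> omega
  rcases h.vertex_of_mem_of_mem hd hi hj hij hzi h1 with ⟨e, e1, -⟩ | ⟨e, e1, -⟩
  · have hdj : d j = (1, 0) ∨ d j = (0, 1) := by
      rw [mem_segSet] at h2
      rw [← e1] at c h2
      rcases hw with rfl | rfl <;> rcases c with ⟨f, c⟩ | ⟨f, c⟩ | ⟨f, c⟩ | ⟨f, c⟩ <;> simp [f] <;>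
        dsimp only at h2 <;> omega
    refine ⟨j, hj, h2, fun k hk => ?_, fun e' => ?_⟩
    · rcases Nat.lt_or_ge k j with hk' | hk'
      · exact hdir k (by omega)
      · rwa [show k = j by omega]
    · rw [← e1] at e'
      rcases hw with rfl | rfl <;> simp [Prod.ext_iff] at e'
  · have := hstart e1
    omega

lemma not_vArm_of_onInitial (hd : IsDirSeq d) (h : Realizes n d p) {z : ℤ × ℤ}
    (hz : OnInitial n d p z) (h1 : HArm n p z) : ¬ VArm n p z := by
  rintro ⟨k, hk, hk1, hk2⟩
  obtain ⟨j, hj, hj1, hj2⟩ := h1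
  obtain ⟨i, hi, hzi, hdir, hstart⟩ := hz
  have cj := h.step_cases hd hj
  have ck := h.step_cases hd hk
  have hjk : j ≠ k := by
    rintro rfl
    rw [mem_segSet] at hj1 hj2 hk2
    dsimp only at hj2 hk2
    omega
  have a := h.vertex_of_mem_of_mem hd hj hk hjk hj1 hk1
  by_cases hij : i = j
  · subst hij
    rw [mem_segSet] at hj2
    dsimp only at hj2
    rcases a with ⟨e, -, e1⟩ | ⟨e, e1, -⟩
    · rw [← e1] at cj hj2
      rcases hdir i le_rfl with f | f <;> simp [f] at cj <;> omega
    · have := hstart e1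
      omega
  by_cases hik : i = k
  · subst hik
    rw [mem_segSet] at hk2
    dsimp only at hk2
    rcases a with ⟨e, e1, -⟩ | ⟨e, -, e1⟩
    · have := hstart e1
      omega
    · rw [← e1] at ck hk2
      rcases hdir i le_rfl with f | f <;> simp [f] at ck <;> omega
  have b := h.vertex_of_mem_of_mem hd hi hj hij hzi hj1
  have c := h.vertex_of_mem_of_mem hd hi hk hik hzi hk1
  omega

lemma OnCorner.not_arm (hd : IsDirSeq d) (h : Realizes n d p) {z : ℤ × ℤ}
    (hz : OnCorner n p z) : ¬ HArm n p z ∧ ¬ VArm n p z := by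
  obtain ⟨⟨i, hi, hi1, hi2⟩, j, hj, hj1, hj2⟩ := hz
  simp only [sub_add_cancel] at hi2 hj2
  have hij : i ≠ j := by
    rintro rfl
    have := h.step_cases hd hi
    rw [mem_segSet] at hi1 hi2 hj1
    dsimp only at hi1 hi2 hj1
    omega
  have a := h.vertex_of_mem_of_mem hd hi hj hij hi2 hj2
  have key : ∀ k ≤ n, ∀ w, z ∈ segSet (p k) (p (k + 1)) → w ∈ segSet (p k) (p (k + 1)) →
      w = (z.1 + 1, z.2) ∨ w = (z.1, z.2 + 1) → False := by
    intro k hk w hk1 hk2 hw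
    have hki : i ≠ k := by
      rintro rfl
      have := h.step_cases hd hi
      have e : p i = z ∨ p (i + 1) = z := by
        rcases a with ⟨-, -, e⟩ | ⟨-, e, -⟩
        exacts [.inr e.symm, .inl e.symm]
      rw [mem_segSet] at hi1 hk2
      dsimp only at hi1
      rcases e with e | e <;> rcases hw with rfl | rfl <;> rw [e] at this hi1 hk2 <;>
        dsimp only at hk2 <;> omega
    have hkj : j ≠ k := by
      rintro rfl
      have := h.step_cases hd hj
      have e : p j = z ∨ p (j + 1) = z := by
        rcases a with ⟨-, e, -⟩ | ⟨-, -, e⟩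
        exacts [.inl e.symm, .inr e.symm]
      rw [mem_segSet] at hj1 hk2
      dsimp only at hj1
      rcases e with e | e <;> rcases hw with rfl | rfl <;> rw [e] at this hj1 hk2 <;>
        dsimp only at hk2 <;> omega
    have b := h.vertex_of_mem_of_mem hd hi hk hki hi2 hk1
    have c := h.vertex_of_mem_of_mem hd hj hk hkj hj2 hk1
    omega
  exact ⟨fun ⟨k, hk, hk1, hk2⟩ => key k hk _ hk1 hk2 (.inl rfl),
    fun ⟨k, hk, hk1, hk2⟩ => key k hk _ hk1 hk2 (.inr rfl)⟩

open Classical in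
/-- A north-east staircase separating the points `ReachR`-reachable from the origin from the
`ReachU`-reachable ones.  On the antidiagonal `x + y = k` it passes through the point with
abscissa `(stair n p k).1`, and `(stair n p k).2` says whether this point may be
`ReachU`-reachable. -/
noncomputable def stair (n : ℕ) (p : ℕ → ℤ × ℤ) : ℕ → ℤ × Prop
  | 0 => (0, True)
  | k + 1 =>
    let a := (stair n p k).1
    if VArm n p (a, k - a) then (a, (stair n p k).2 ∨ HArm n p (a - 1, k - a + 1))
    else (a + 1, (stair n p k).2 ∧ HArm n p (a, k - a))

lemma stair_succ_of_vArm {k : ℕ} (h : VArm n p ((stair n p k).1, k - (stair n p k).1)) :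
    stair n p (k + 1) = ((stair n p k).1,
      ((stair n p k).2 ∨ HArm n p ((stair n p k).1 - 1, k - (stair n p k).1 + 1))) := by
  rw [stair]; exact if_pos h

lemma stair_succ_of_not_vArm {k : ℕ} (h : ¬ VArm n p ((stair n p k).1, k - (stair n p k).1)) :
    stair n p (k + 1) = ((stair n p k).1 + 1,
      ((stair n p k).2 ∧ HArm n p ((stair n p k).1, k - (stair n p k).1))) := by
  rw [stair]; exact if_neg h

lemma stair_succ_fst_le (k : ℕ) : (stair n p k).1 ≤ (stair n p (k + 1)).1 ∧
    (stair n p (k + 1)).1 ≤ (stair n p k).1 + 1 := by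
  by_cases h : VArm n p ((stair n p k).1, k - (stair n p k).1)
  · rw [stair_succ_of_vArm h]; dsimp only; omega
  · rw [stair_succ_of_not_vArm h]; dsimp only; omega

/-- The points at which the staircase is allowed to be `ReachU`-reachable. -/
def StairGood (n : ℕ) (d p : ℕ → ℤ × ℤ) (z : ℤ × ℤ) : Prop :=
  OnInitial n d p z ∨ OnCorner n p z ∨ z = (0, 0)

lemma StairGood.onInitial (hd : IsDirSeq d) (h : Realizes n d p) {z : ℤ × ℤ}
    (hz : StairGood n d p z) (harm : HArm n p z ∨ VArm n p z) : OnInitial n d p z := by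
  rcases hz with hz | hz | rfl
  · exact hz
  · have := hz.not_arm hd h
    tauto
  · rw [← h.zero] at harm ⊢
    have c := h.step_cases hd (Nat.zero_le n)
    refine ⟨0, Nat.zero_le n, left_mem_segSet _ _, fun j hj => ?_, fun _ => rfl⟩
    obtain rfl : j = 0 := by omega
    rcases harm with ⟨i, hi, h1, h2⟩ | ⟨i, hi, h1, h2⟩ <;>
      obtain rfl := h.index_eq_zero_of_mem hd hi h1 <;> rw [mem_segSet] at h2 <;>
      dsimp only at h2 <;> rcases c with ⟨f, c⟩ | ⟨f, c⟩ | ⟨f, c⟩ | ⟨f, c⟩ <;> simp [f] <;> omega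

lemma stairGood_stair (hd : IsDirSeq d) (h : Realizes n d p) (k : ℕ) (hk : (stair n p k).2) :
    StairGood n d p ((stair n p k).1, k - (stair n p k).1) := by
  induction k with
  | zero => exact .inr (.inr (by simp [stair]))
  | succ k ih =>
    by_cases hv : VArm n p ((stair n p k).1, k - (stair n p k).1)
    · rw [stair_succ_of_vArm hv] at hk ⊢
      dsimp only at hk ⊢
      rcases hk with hk | hk
      · obtain ⟨j, hj, h1, h2⟩ := id hv
        left
        convert ((ih hk).onInitial hd h (.inr hv)).of_arm hd h hj h1 h2 (.inr rfl) using 2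
        push_cast; ring
      · refine .inr (.inl ⟨?_, ?_⟩)
        · convert hk using 2; push_cast; ring
        · convert hv using 2; push_cast; ring
    · rw [stair_succ_of_not_vArm hv] at hk ⊢
      dsimp only at hk ⊢
      obtain ⟨j, hj, h1, h2⟩ := id hk.2
      left
      convert ((ih hk.1).onInitial hd h (.inl hk.2)).of_arm hd h hj h1 h2 (.inl rfl) using 2
      push_cast; ring

lemma stair_of_not_vArm (hd : IsDirSeq d) (h : Realizes n d p) {k : ℕ} (hk : (stair n p k).2)
    (h1 : HArm n p ((stair n p k).1, k - (stair n p k).1)) :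
    ¬ VArm n p ((stair n p k).1, k - (stair n p k).1) :=
  not_vArm_of_onInitial hd h ((stairGood_stair hd h k hk).onInitial hd h (.inl h1)) h1

lemma ReachR.stair_le {z : ℤ × ℤ} (hz : ReachR n p (0, 0) z) :
    (stair n p (z.1 + z.2).toNat).1 ≤ z.1 := by
  induction hz with
  | refl => simp [stair]
  | @east b _ ih =>
    dsimp only
    rcases lt_or_ge (b.1 + b.2) 0 with hneg | hpos
    · rw [show (b.1 + b.2).toNat = 0 by omega] at ih
      rw [show (b.1 + 1 + b.2).toNat = 0 by omega]
      omega
    · rw [show (b.1 + 1 + b.2).toNat = (b.1 + b.2).toNat + 1 by omega]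
      have := stair_succ_fst_le (n := n) (p := p) (b.1 + b.2).toNat
      omega
  | @north b _ hv ih =>
    dsimp only
    rcases lt_or_ge (b.1 + b.2) 0 with hneg | hpos
    · rw [show (b.1 + b.2).toNat = 0 by omega] at ih
      rwa [show (b.1 + (b.2 + 1)).toNat = 0 by omega]
    · rw [show (b.1 + (b.2 + 1)).toNat = (b.1 + b.2).toNat + 1 by omega]
      have := stair_succ_fst_le (n := n) (p := p) (b.1 + b.2).toNat
      rcases ih.lt_or_eq with hlt | heq
      · omega
      · have e : ((stair n p (b.1 + b.2).toNat).1,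
            ((b.1 + b.2).toNat : ℤ) - (stair n p (b.1 + b.2).toNat).1) = b := by
          ext <;> dsimp only <;> omega
        rw [stair_succ_of_vArm (by rwa [e])]
        exact ih
  | @south b _ hv ih =>
    dsimp only at ih
    rcases lt_or_ge (b.1 + b.2) 0 with hneg | hpos
    · rw [show (b.1 + (b.2 + 1)).toNat = 0 by omega] at ih
      rwa [show (b.1 + b.2).toNat = 0 by omega]
    · rw [show (b.1 + (b.2 + 1)).toNat = (b.1 + b.2).toNat + 1 by omega] at ih
      have := stair_succ_fst_le (n := n) (p := p) (b.1 + b.2).toNat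
      omega

lemma ReachU.stair_le (hd : IsDirSeq d) (h : Realizes n d p) {z : ℤ × ℤ}
    (hz : ReachU n p (0, 0) z) : 0 ≤ z.2 ∧ (z.1 < (stair n p (z.1 + z.2).toNat).1 ∨
      (z.1 = (stair n p (z.1 + z.2).toNat).1 ∧ (stair n p (z.1 + z.2).toNat).2)) := by
  -- one step between consecutive antidiagonals
  have succ : ∀ z : ℤ × ℤ, 0 ≤ z.1 + z.2 → ∃ k : ℕ, (k : ℤ) = z.1 + z.2 ∧
      (z.1 + z.2).toNat = k ∧ (z.1 + (z.2 + 1)).toNat = k + 1 ∧ (z.1 + 1 + z.2).toNat = k + 1 :=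
    fun z hz => ⟨(z.1 + z.2).toNat, by omega, rfl, by omega, by omega⟩
  refine hz.induction (K := fun z => 0 ≤ z.2 ∧ (z.1 < (stair n p (z.1 + z.2).toNat).1 ∨
      (z.1 = (stair n p (z.1 + z.2).toNat).1 ∧ (stair n p (z.1 + z.2).toNat).2))) ?_ ?_ ?_ ?_
  · simp [stair]
  · rintro z ⟨h2, hz⟩
    refine ⟨by dsimp only; omega, ?_⟩
    dsimp only
    rcases lt_or_ge (z.1 + z.2) 0 with hneg | hpos
    · rw [show (z.1 + (z.2 + 1)).toNat = 0 by omega]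
      simp only [stair]; omega
    obtain ⟨k, hk, e0, e1, -⟩ := succ z hpos
    rw [e0] at hz
    rw [e1]
    by_cases hv : VArm n p ((stair n p k).1, k - (stair n p k).1)
    · rw [stair_succ_of_vArm hv]
      exact hz.imp id (And.imp id .inl)
    · rw [stair_succ_of_not_vArm hv]
      dsimp only
      omega
  · rintro z ha ⟨h2, hz⟩
    refine ⟨h2, ?_⟩
    dsimp only
    rcases lt_or_ge (z.1 + z.2) 0 with hneg | hpos
    · rw [show (z.1 + 1 + z.2).toNat = 0 by omega]
      simp only [stair, and_true]; omega
    obtain ⟨k, hk, e0, -, e1⟩ := succ z hpos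
    rw [e0] at hz
    rw [e1]
    have e : z.1 = (stair n p k).1 → z = ((stair n p k).1, k - (stair n p k).1) := fun e => by
      ext <;> dsimp only <;> omega
    by_cases hv : VArm n p ((stair n p k).1, k - (stair n p k).1)
    · rw [stair_succ_of_vArm hv]
      dsimp only
      rcases hz with hz | ⟨hz, hb⟩
      · rcases lt_or_eq_of_le (Int.add_one_le_iff.2 hz) with hlt | heq
        · exact .inl hlt
        · refine .inr ⟨heq, .inr ?_⟩
          convert ha using 1
          ext <;> dsimp only <;> omega
      · exact absurd hv (stair_of_not_vArm hd h hb (e hz ▸ ha))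
    · rw [stair_succ_of_not_vArm hv]
      dsimp only
      rcases hz with hz | ⟨hz, hb⟩
      · exact .inl (by omega)
      · exact .inr ⟨by omega, hb, e hz ▸ ha⟩
  · rintro z ha ⟨h2, hz⟩
    dsimp only at h2 hz
    refine ⟨h2, ?_⟩
    rcases lt_or_ge (z.1 + z.2) 0 with hneg | hpos
    · rw [show (z.1 + z.2).toNat = 0 by omega]
      simp only [stair]; omega
    obtain ⟨k, hk, e0, -, e1⟩ := succ z hpos
    rw [e0]
    rw [e1] at hz
    by_cases hv : VArm n p ((stair n p k).1, k - (stair n p k).1)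
    · rw [stair_succ_of_vArm hv] at hz
      dsimp only at hz
      omega
    · rw [stair_succ_of_not_vArm hv] at hz
      dsimp only at hz
      rcases hz with hz | ⟨hz, hb, -⟩
      · exact .inl (by omega)
      · exact .inr ⟨by omega, hb⟩

/-- If the origin pushes the endpoint both to the east and to the north, then the chain is a
north-east staircase. -/
theorem Realizes.eq_east_or_north (hd : IsDirSeq d) (h : Realizes n d p)
    (h1 : ReachR n p (0, 0) (p (n + 1))) (h2 : ReachU n p (0, 0) (p (n + 1))) {i : ℕ}
    (hi : i ≤ n) : d i = (1, 0) ∨ d i = (0, 1) := by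
  have hx := h1.le
  have ha := h1.stair_le
  obtain ⟨hy, hb⟩ := h2.stair_le hd h
  rcases hb with hb | ⟨hb, hB⟩
  · omega
  have hgood := stairGood_stair hd h _ hB
  have e : ((stair n p ((p (n + 1)).1 + (p (n + 1)).2).toNat).1,
      (((p (n + 1)).1 + (p (n + 1)).2).toNat : ℤ) -
        (stair n p ((p (n + 1)).1 + (p (n + 1)).2).toNat).1) = p (n + 1) := by
    ext <;> dsimp only at * <;> omega
  rw [e] at hgood
  rcases hgood with ⟨j, hj, hj1, hdir, -⟩ | ⟨⟨j, hj, hj1, hj2⟩, k, hk, hk1, hk2⟩ | h0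
  · obtain rfl := h.index_eq_of_last_mem hd hj hj1
    exact hdir i hi
  · simp only [sub_add_cancel] at hj2 hk2
    obtain rfl := h.index_eq_of_last_mem hd hj hj2
    obtain rfl := h.index_eq_of_last_mem hd hk hk2
    have := h.step_cases hd hj
    rw [mem_segSet] at hj1 hk1
    dsimp only at hj1 hk1
    omega
  · exact absurd ⟨p, h, h0⟩ (zero_notMem_reach hd)

end Staircase

/-- The direction `v` occurs among `d 0, …, d n`. -/
def Occurs (n : ℕ) (d : ℕ → ℤ × ℤ) (v : ℤ × ℤ) : Prop := ∃ i ≤ n, d i = v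

section Trichotomy

variable {n : ℕ} {d p : ℕ → ℤ × ℤ}

lemma ReachR.to_reflX {a b : ℤ × ℤ} (h : ReachR n p a b) :
    ReachR n (fun i => reflX (p i)) (reflX b) (reflX a) :=
  ReachR.of_reflX (by simpa using h)

lemma ReachR.to_reflY {a b : ℤ × ℤ} (h : ReachR n p a b) :
    ReachR n (fun i => reflY (p i)) (reflY a) (reflY b) :=
  ReachR.of_reflY (by simpa using h)

lemma ReachU.to_reflX {a b : ℤ × ℤ} (h : ReachU n p a b) :
    ReachU n (fun i => reflX (p i)) (reflX a) (reflX b) :=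
  ReachU.of_reflX (by simpa using h)

lemma ReachU.to_reflY {a b : ℤ × ℤ} (h : ReachU n p a b) :
    ReachU n (fun i => reflY (p i)) (reflY b) (reflY a) :=
  ReachU.of_reflY (by simpa using h)

lemma Realizes.eq_west_or_north (hd : IsDirSeq d) (h : Realizes n d p)
    (h1 : ReachR n p (p (n + 1)) (0, 0)) (h2 : ReachU n p (0, 0) (p (n + 1))) {i : ℕ}
    (hi : i ≤ n) : d i = (-1, 0) ∨ d i = (0, 1) := by
  have := h.reflectX.eq_east_or_north hd.reflectX h1.to_reflX h2.to_reflX hi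
  simp only [reflX, Prod.ext_iff] at this ⊢
  omega

lemma Realizes.eq_horizontal_or_north (hd : IsDirSeq d) (h : Realizes n d p)
    (h1 : ReachR n p (p (n + 1)) (0, 0) ∨ ReachR n p (0, 0) (p (n + 1)))
    (h2 : ReachU n p (0, 0) (p (n + 1))) :
    (¬ Occurs n d (1, 0) ∨ ¬ Occurs n d (-1, 0)) ∧ ¬ Occurs n d (0, -1) := by
  rcases h1 with h1 | h1
  · have key := fun i hi => h.eq_west_or_north hd h1 h2 (i := i) hi
    refine ⟨.inl ?_, ?_⟩ <;> rintro ⟨i, hi, e⟩ <;> simpa [e] using key i hi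
  · have key := fun i hi => h.eq_east_or_north hd h1 h2 (i := i) hi
    refine ⟨.inr ?_, ?_⟩ <;> rintro ⟨i, hi, e⟩ <;> simpa [e] using key i hi

lemma Occurs.reflectY {v : ℤ × ℤ} (h : Occurs n d v) :
    Occurs n (fun i => reflY (d i)) (reflY v) := by
  obtain ⟨i, hi, rfl⟩ := h
  exact ⟨i, hi, rfl⟩

lemma Occurs.swap {v : ℤ × ℤ} (h : Occurs n d v) :
    Occurs n (fun i => (d i).swap) v.swap := by
  obtain ⟨i, hi, rfl⟩ := h
  exact ⟨i, hi, rfl⟩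

/-- A reachable point lies in a fully reachable row or column, unless no two opposite directions
occur. -/
theorem fullRow_or_fullCol_of_mem_reach (hd : IsDirSeq d) {z : ℤ × ℤ} (hz : z ∈ reach n d) :
    FullRow n d z.2 ∨ FullCol n d z.1 ∨ ((¬ Occurs n d (1, 0) ∨ ¬ Occurs n d (-1, 0)) ∧
      (¬ Occurs n d (0, 1) ∨ ¬ Occurs n d (0, -1))) := by
  obtain ⟨p, h, rfl⟩ := hz
  by_cases hR : ReachR n p (p (n + 1)) (0, 0) ∨ ReachR n p (0, 0) (p (n + 1))
  · by_cases hU : ReachU n p (p (n + 1)) (0, 0)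
    · have := h.reflectY.eq_horizontal_or_north hd.reflectY
        (hR.imp ReachR.to_reflY ReachR.to_reflY) hU.to_reflY
      refine .inr (.inr ⟨?_, ?_⟩)
      · exact this.1.imp (fun hn ho => hn (by simpa [reflY] using ho.reflectY))
          (fun hn ho => hn (by simpa [reflY] using ho.reflectY))
      · exact .inl fun ho => this.2 (by simpa [reflY] using ho.reflectY)
    by_cases hU' : ReachU n p (0, 0) (p (n + 1))
    · have := h.eq_horizontal_or_north hd hR hU'
      exact .inr (.inr ⟨this.1, .inr this.2⟩)
    exact .inr (.inl (h.fullCol hd hU hU'))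
  · push Not at hR
    exact .inl (h.fullRow hd hR.1 hR.2)

end Trichotomy

/-! ### Existence of fully reachable lines -/

section FullLines

variable {n : ℕ} {d p : ℕ → ℤ × ℤ}

/-- Some chain can be pushed freely to the north and to the south. -/
def Loose (n : ℕ) (d : ℕ → ℤ × ℤ) : Prop :=
  ∃ p, Realizes n d p ∧ ¬ ReachU n p (0, 0) (p (n + 1)) ∧ ¬ ReachU n p (p (n + 1)) (0, 0)

lemma Loose.exists_fullCol (hd : IsDirSeq d) (h : Loose n d) : ∃ x, FullCol n d x := by
  obtain ⟨p, hp, h1, h2⟩ := h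
  exact ⟨_, hp.fullCol hd h2 h1⟩

lemma Loose.of_reflectY (h : Loose n fun i => reflY (d i)) : Loose n d := by
  obtain ⟨p, hp, h1, h2⟩ := h
  refine ⟨fun i => reflY (p i), by simpa using hp.reflectY, fun hU => h2 ?_, fun hU => h1 ?_⟩
  · simpa [reflY] using hU.of_reflY
  · simpa [reflY] using hU.of_reflY

/-- The chain scaled by two, with one more unit segment. -/
def doubleChain (n : ℕ) (d p : ℕ → ℤ × ℤ) (i : ℕ) : ℤ × ℤ :=
  if i ≤ n + 1 then (2 * (p i).1, 2 * (p i).2)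
  else (2 * (p (n + 1)).1 + (d (n + 1)).1, 2 * (p (n + 1)).2 + (d (n + 1)).2)

lemma doubleChain_of_le {i : ℕ} (hi : i ≤ n + 1) : doubleChain n d p i = (2 * (p i).1, 2 * (p i).2) :=
  if_pos hi

lemma doubleChain_last : doubleChain n d p (n + 1 + 1) =
    (2 * (p (n + 1)).1 + (d (n + 1)).1, 2 * (p (n + 1)).2 + (d (n + 1)).2) :=
  if_neg (by omega)

lemma reflY_doubleChain (i : ℕ) :
    reflY (doubleChain n d p i) = doubleChain n (fun i => reflY (d i)) (fun i => reflY (p i)) i := by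
  unfold doubleChain
  split_ifs <;> simp [reflY]; ring

lemma Realizes.double (hd : IsDirSeq d) (h : Realizes n d p) :
    Realizes (n + 1) d (doubleChain n d p) where
  zero := by rw [doubleChain_of_le (by omega), h.zero]; rfl
  step i hi := by
    rcases Nat.lt_or_ge i (n + 1) with hlt | hge
    · obtain ⟨t, ht, h1, h2⟩ := h.step i (by omega)
      rw [doubleChain_of_le (by omega), doubleChain_of_le (by omega)]
      exact ⟨2 * t, by omega, by dsimp only; rw [h1]; ring, by dsimp only; rw [h2]; ring⟩
    · obtain rfl : i = n + 1 := by omega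
      rw [doubleChain_of_le le_rfl, doubleChain_last]
      exact ⟨1, one_pos, by simp, by simp⟩
  disj i j hij hj z hi1 hj1 := by
    rw [doubleChain_of_le (by omega), doubleChain_of_le (by omega)] at hi1
    rw [doubleChain_of_le (by omega)] at hj1
    rcases Nat.lt_or_ge j (n + 1) with hlt | hge
    · rw [doubleChain_of_le (by omega)] at hj1
      refine h.disj i j hij (by omega) (z.1 / 2, z.2 / 2) ?_ ?_ <;> rw [mem_segSet] at * <;>
        dsimp only at * <;> omega
    · obtain rfl : j = n + 1 := by omega
      rw [doubleChain_last] at hj1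
      have : i = n := h.index_eq_of_last_mem hd (by omega) (by
        rw [mem_segSet] at *
        rcases hd.unit (n + 1) with e | e | e | e <;> rw [e] at hj1 <;> dsimp only at * <;> omega)
      omega

lemma ReachU.north {a b : ℤ × ℤ} (h : ReachU n p a b) : ReachU n p a (b.1, b.2 + 1) :=
  ReachR.east h

lemma ReachU.east {a b : ℤ × ℤ} (h : ReachU n p a b) (hb : HArm n p b) :
    ReachU n p a (b.1 + 1, b.2) := ReachR.north h (vArm_swap.2 hb)

lemma ReachU.west {a b : ℤ × ℤ} (h : ReachU n p a (b.1 + 1, b.2)) (hb : HArm n p b) :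
    ReachU n p a b := ReachR.south (b := b.swap) h (vArm_swap.2 hb)

lemma Realizes.not_reachU_double (hd : IsDirSeq d) (h : Realizes n d p)
    (h0 : ¬ ReachU n p (0, 0) (p (n + 1))) :
    ¬ ReachU (n + 1) (doubleChain n d p) (0, 0) (doubleChain n d p (n + 1 + 1)) := by
  intro hU
  let S : ℤ → ℤ → Prop := fun x y => ReachU n p (0, 0) (x, y)
  have hS : ∀ x y, x = (p (n + 1)).1 → y = (p (n + 1)).2 → ¬ S x y := by
    rintro x y rfl rfl
    exact h0
  let K : ℤ × ℤ → Prop := fun z => S (z.1 / 2) (z.2 / 2) ∧ S ((z.1 + 1) / 2) (z.2 / 2)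
  have harm : ∀ z, HArm (n + 1) (doubleChain n d p) z → (K z ↔ K (z.1 + 1, z.2)) := by
    rintro z ⟨i, hi, hi1, hi2⟩
    rw [doubleChain_of_le (by omega)] at hi1 hi2
    rcases Nat.lt_or_ge i (n + 1) with hlt | hge
    · rw [doubleChain_of_le (by omega)] at hi1 hi2
      have c := h.step_cases hd (show i ≤ n by omega)
      have ha : HArm n p (z.1 / 2, z.2 / 2) := by
        refine ⟨i, by omega, ?_, ?_⟩ <;> rw [mem_segSet] at * <;> dsimp only at * <;> omega
      have hiff : S (z.1 / 2) (z.2 / 2) ↔ S (z.1 / 2 + 1) (z.2 / 2) :=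
        ⟨fun hs => ReachU.east hs ha, fun hs => ReachU.west hs ha⟩
      simp only [K]
      rcases Int.emod_two_eq_zero_or_one z.1 with hz | hz
      · rw [show (z.1 + 1) / 2 = z.1 / 2 by omega, show (z.1 + 1 + 1) / 2 = z.1 / 2 + 1 by omega]
        tauto
      · rw [show (z.1 + 1) / 2 = z.1 / 2 + 1 by omega,
          show (z.1 + 1 + 1) / 2 = z.1 / 2 + 1 by omega]
        tauto
    · obtain rfl : i = n + 1 := by omega
      rw [doubleChain_last] at hi1 hi2
      rw [mem_segSet] at hi1 hi2
      rcases hd.unit (n + 1) with e | e | e | e <;> rw [e] at hi1 hi2 <;>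
        dsimp only at hi1 hi2 <;> try omega
      · exact iff_of_false (fun hk => hS _ _ (by omega) (by omega) hk.1)
          (fun hk => hS _ _ (by dsimp only; omega) (by dsimp only; omega) hk.1)
      · exact iff_of_false (fun hk => hS _ _ (by omega) (by omega) hk.2)
          (fun hk => hS _ _ (by dsimp only; omega) (by dsimp only; omega) hk.1)
  have hlast : K (doubleChain n d p (n + 1 + 1)) := by
    refine hU.induction (K := K) ⟨.refl, .refl⟩ (fun z hz => ?_)
      (fun z hz => (harm z hz).1) (fun z hz => (harm z hz).2)
    simp only [K] at hz ⊢
    rcases Int.emod_two_eq_zero_or_one z.2 with hz2 | hz2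
    · rwa [show (z.2 + 1) / 2 = z.2 / 2 by omega]
    · rw [show (z.2 + 1) / 2 = z.2 / 2 + 1 by omega]
      exact ⟨hz.1.north, hz.2.north⟩
  simp only [K, doubleChain_last] at hlast
  rcases hd.unit (n + 1) with e | e | e | e <;> rw [e] at hlast <;> dsimp only at hlast
  · exact hS _ _ (by omega) (by omega) hlast.1
  · exact hS _ _ (by omega) (by omega) hlast.2
  · exact hS _ _ (by omega) (by omega) hlast.1
  · exact hS _ _ (by dsimp only; omega) (by dsimp only; omega) hlast.1.north

lemma Loose.succ (hd : IsDirSeq d) (h : Loose n d) : Loose (n + 1) d := by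
  obtain ⟨p, hp, h1, h2⟩ := h
  refine ⟨_, hp.double hd, hp.not_reachU_double hd h1, fun hU => ?_⟩
  refine hp.reflectY.not_reachU_double hd.reflectY (fun hU' => h2 ?_) ?_
  · simpa [reflY] using hU'.of_reflY
  · have := hU.to_reflY
    simp only [reflY_doubleChain] at this
    exact this

lemma Loose.mono (hd : IsDirSeq d) {m : ℕ} (h : Loose m d) (hmn : m ≤ n) : Loose n d := by
  induction n, hmn using Nat.le_induction with
  | base => exact h
  | succ k _ ih => exact ih.succ hd

end FullLines

section Extremal

variable {n : ℕ} {d p : ℕ → ℤ × ℤ}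

/-- The endpoint is further in the direction of the last segment than any other vertex, by at
least two. -/
def Extremal (n : ℕ) (d p : ℕ → ℤ × ℤ) : Prop :=
  ∀ i ≤ n, (p i).1 * (d n).1 + (p i).2 * (d n).2 + 1 <
    (p (n + 1)).1 * (d n).1 + (p (n + 1)).2 * (d n).2

lemma Realizes.append (h : Realizes n d p) (t : ℤ) (ht : 0 < t)
    (hdisj : ∀ i < n, ∀ z ∈ segSet (p i) (p (i + 1)), z ∉ segSet (p (n + 1))
      ((p (n + 1)).1 + t * (d (n + 1)).1, (p (n + 1)).2 + t * (d (n + 1)).2)) :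
    Realizes (n + 1) d (Function.update p (n + 2)
      ((p (n + 1)).1 + t * (d (n + 1)).1, (p (n + 1)).2 + t * (d (n + 1)).2)) := by
  have hu : ∀ v, ∀ i ≤ n + 1, Function.update p (n + 2) v i = p i := fun v i hi =>
    Function.update_of_ne (by omega) _ _
  refine ⟨by rw [hu _ _ (by omega), h.zero], fun i hi => ?_, fun i j hij hj z hzi hzj => ?_⟩
  · rw [hu _ i hi]
    rcases Nat.lt_or_ge i (n + 1) with hlt | hge
    · rw [hu _ _ (by omega)]
      exact h.step i (by omega)
    · obtain rfl : i = n + 1 := by omega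
      rw [Function.update_self]
      exact ⟨t, ht, rfl, rfl⟩
  · rw [hu _ i (by omega), hu _ (i + 1) (by omega)] at hzi
    rw [hu _ j hj] at hzj
    rcases Nat.lt_or_ge j (n + 1) with hlt | hge
    · rw [hu _ _ (by omega)] at hzj
      exact h.disj i j hij (by omega) z hzi hzj
    · obtain rfl : j = n + 1 := by omega
      rw [Function.update_self] at hzj
      exact hdisj i (by omega) z hzi hzj

lemma Extremal.append (hd : IsDirSeq d) (h : Realizes n d p) (hp : Extremal n d p) :
    ∃ q, Realizes (n + 1) d q ∧ Extremal (n + 1) d q ∧ (∀ i ≤ n + 1, q i = p i) ∧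
      ((q (n + 2)).1 - (q (n + 1)).1) * (d n).1 + ((q (n + 2)).2 - (q (n + 1)).2) * (d n).2 = 0 := by
  obtain ⟨M, hM⟩ : ∃ M : ℤ, ∀ i ≤ n + 1,
      (p i).1 * (d (n + 1)).1 + (p i).2 * (d (n + 1)).2 ≤ M := by
    obtain ⟨M, hM⟩ := ((Set.finite_Iic (n + 1)).image
      fun i => (p i).1 * (d (n + 1)).1 + (p i).2 * (d (n + 1)).2).bddAbove
    exact ⟨M, fun i hi => hM ⟨i, hi, rfl⟩⟩
  have hlast := hM (n + 1) le_rfl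
  have hu : ∀ v, ∀ i ≤ n + 1, Function.update p (n + 2) v i = p i := fun v i hi =>
    Function.update_of_ne (by omega) _ _
  refine ⟨_, h.append (M + 2 - ((p (n + 1)).1 * (d (n + 1)).1 + (p (n + 1)).2 * (d (n + 1)).2))
    (by omega) fun i hi z hz hz' => ?_, fun i hi => ?_, hu _, ?_⟩
  · have a := hp i hi.le
    have b := hp (i + 1) hi
    rw [mem_segSet] at hz hz'
    rcases hd.perp_cases n with ⟨e | e, f | f⟩ | ⟨e | e, f | f⟩ <;>
      simp only [e, f] at a b hz' <;> omega
  · have := hM i hi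
    rw [hu _ i hi, Function.update_self]
    rcases hd.unit (n + 1) with f | f | f | f <;> simp only [f] at this hlast ⊢ <;> omega
  · rw [hu _ (n + 1) le_rfl, Function.update_self]
    rcases hd.perp_cases n with ⟨e | e, f | f⟩ | ⟨e | e, f | f⟩ <;> simp [e, f]

lemma exists_extremal (hd : IsDirSeq d) (n : ℕ) : ∃ p, Realizes n d p ∧ Extremal n d p := by
  induction n with
  | zero =>
    refine ⟨fun i => (2 * i * (d 0).1, 2 * i * (d 0).2), ⟨by simp, fun i hi => ?_, ?_⟩, ?_⟩
    · obtain rfl : i = 0 := by omega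
      exact ⟨2, two_pos, by simp, by simp⟩
    · intro i j h1 h2; omega
    · intro i hi
      obtain rfl : i = 0 := by omega
      rcases hd.unit 0 with f | f | f | f <;> simp [f]
  | succ k ih =>
    obtain ⟨p, h, hp⟩ := ih
    obtain ⟨q, hq, hq', -⟩ := hp.append hd h
    exact ⟨q, hq, hq'⟩

/-- A hook opening upwards can be made so deep and so wide that its end moves freely. -/
lemma loose_of_south_north (hd : IsDirSeq d) (h1 : d n = (0, -1)) (h2 : d (n + 2) = (0, 1)) :
    Loose (n + 2) d := by
  obtain ⟨p, h, hp⟩ := exists_extremal hd n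
  obtain ⟨q, hq, hq', hqp, hflat⟩ := hp.append hd h
  replace hq' : ∀ i ≤ n + 1, (q i).1 * (d (n + 1)).1 + (q i).2 * (d (n + 1)).2 + 1 <
    (q (n + 2)).1 * (d (n + 1)).1 + (q (n + 2)).2 * (d (n + 1)).2 := hq'
  have hdir : d (n + 1) = (1, 0) ∨ d (n + 1) = (-1, 0) := by
    rcases hd.perp_cases n with ⟨e | e, -⟩ | ⟨-, e⟩
    · simp [h1] at e
    · simp [h1] at e
    · exact e
  have hext : ∀ i ≤ n + 1, (q i).1 ≠ (q (n + 2)).1 := fun i hi => by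
    have := hq' i hi
    rcases hdir with e | e <;> simp only [e] at this <;> omega
  have hside : ∀ i ≤ n, ∀ z ∈ segSet (q i) (q (i + 1)), z.1 ≠ (q (n + 2)).1 := fun i hi z hz => by
    have a := hq' i (by omega)
    have b := hq' (i + 1) (by omega)
    rw [mem_segSet] at hz
    rcases hdir with e | e <;> simp only [e] at a b <;> omega
  have hbot : (q (n + 2)).2 = (q (n + 1)).2 := by
    simp only [h1] at hflat; omega
  have hdeep : (q (n + 1)).2 + 1 < 0 := by
    have := hp 0 (by omega)
    simp only [h1, h.zero] at this
    rw [hqp _ le_rfl]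
    omega
  have hr := hq.append 1 one_pos fun i hi z hz hz' => by
    refine hside i (by omega) z hz ?_
    rw [mem_segSet, h2] at hz'
    simp only [add_assoc, Nat.reduceAdd] at hz'
    omega
  rw [h2] at hr
  have hu : ∀ v, ∀ i ≤ n + 2, Function.update q (n + 3) v i = q i := fun v i hi =>
    Function.update_of_ne (by omega) _ _
  refine ⟨_, hr, fun hU => ?_, fun hU => ?_⟩
  · have := ReachR.le hU
    rw [Function.update_self] at this
    simp only [Prod.fst_swap, add_assoc, Nat.reduceAdd] at this
    omega
  · refine hext 0 (by omega) ?_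
    rw [hq.zero]
    rw [Function.update_self] at hU
    have harm : ∀ z, HArm (n + 2) (Function.update q (n + 3)
        ((q (n + 2)).1 + 1 * 0, (q (n + 2)).2 + 1 * 1)) z →
        (q (n + 2)).2 < z.2 → z.1 ≠ (q (n + 2)).1 ∧ z.1 + 1 ≠ (q (n + 2)).1 := by
      rintro z ⟨i, hi, hi1, hi2⟩ hz
      rw [hu _ i hi] at hi1 hi2
      rcases Nat.lt_or_ge i (n + 2) with hlt | hge
      · rw [hu _ _ (by omega)] at hi1 hi2
        rcases Nat.lt_or_ge i (n + 1) with hlt' | hge'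
        · exact ⟨hside i (by omega) z hi1, hside i (by omega) _ hi2⟩
        · obtain rfl : i = n + 1 := by omega
          rw [mem_segSet] at hi1
          rw [show n + 1 + 1 = n + 2 from rfl] at hi1
          omega
      · obtain rfl : i = n + 2 := by omega
        rw [Function.update_self] at hi1 hi2
        rw [mem_segSet] at hi1 hi2
        dsimp only at hi1 hi2
        omega
    refine (hU.induction (K := fun z => z.1 = (q (n + 2)).1 ∧ (q (n + 2)).2 < z.2)
      ?_ ?_ ?_ ?_).1
    · simp only [add_assoc, Nat.reduceAdd]; omega
    · intro z hz; dsimp only; omega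
    · intro z ha hz; exact absurd hz.1 (harm z ha hz.2).1
    · intro z ha hz; exact absurd hz.1 (harm z ha hz.2).2

lemma eq_of_no_switch (hd : IsDirSeq d) {v : ℤ × ℤ} (hv : v.1 = 0)
    (hs : ∀ k, k + 2 ≤ n → d k = v → d (k + 2) ≠ -v) {i : ℕ} (hi : d i = v) (m : ℕ)
    (hm : i + 2 * m ≤ n) : d (i + 2 * m) = v := by
  induction m with
  | zero => exact hi
  | succ m ih =>
    have a := ih (by omega)
    have b := hs _ (by omega) a
    rw [show i + 2 * (m + 1) = i + 2 * m + 2 by ring]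
    have c : (d (i + 2 * m + 2)).1 = 0 := by
      by_contra hne
      exact (hd.perp (i + 2 * m)).1 (by rw [a, hv]) ((hd.perp (i + 2 * m + 1)).2 hne)
    have e := hd.unit (i + 2 * m)
    rw [a] at e
    rcases hd.unit (i + 2 * m + 2) with g | g | g | g <;> rw [g] at b c ⊢ <;>
      simp only [Prod.ext_iff, Prod.fst_neg, Prod.snd_neg, ne_eq] at b c e ⊢ <;> omega

/-- If both vertical directions occur, then some column is fully reachable. -/
theorem exists_fullCol (hd : IsDirSeq d) (h1 : Occurs n d (0, 1)) (h2 : Occurs n d (0, -1)) :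
    ∃ x, FullCol n d x := by
  by_cases hsn : ∃ k, k + 2 ≤ n ∧ d k = (0, -1) ∧ d (k + 2) = (0, 1)
  · obtain ⟨k, hk, e1, e2⟩ := hsn
    exact ((loose_of_south_north hd e1 e2).mono hd hk).exists_fullCol hd
  by_cases hns : ∃ k, k + 2 ≤ n ∧ d k = (0, 1) ∧ d (k + 2) = (0, -1)
  · obtain ⟨k, hk, e1, e2⟩ := hns
    refine Loose.exists_fullCol hd (.of_reflectY (.mono hd.reflectY ?_ hk))
    exact loose_of_south_north hd.reflectY (by simp [e1, reflY]) (by simp [e2, reflY])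
  exfalso
  obtain ⟨i, hi, ei⟩ := h1
  obtain ⟨j, hj, ej⟩ := h2
  have key : ∀ v : ℤ × ℤ, v.1 = 0 → (∀ k, k + 2 ≤ n → d k = v → d (k + 2) ≠ -v) →
      ∀ i j, i ≤ j → j ≤ n → d i = v → d j ≠ -v := by
    intro v hv hs i j hij hj ei ej
    have a := eq_of_no_switch hd hv hs ei ((j - i) / 2) (by omega)
    rcases Nat.mod_two_eq_zero_or_one (j - i) with h | h
    · rw [show i + 2 * ((j - i) / 2) = j by omega, ej] at a
      have := hd.unit j
      rw [ej, a] at this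
      rw [Prod.ext_iff] at a
      simp [Prod.ext_iff, hv] at this a
      omega
    · have b := hd.perp (i + 2 * ((j - i) / 2))
      rw [a, show i + 2 * ((j - i) / 2) + 1 = j by omega, ej] at b
      simp [hv] at b
  rcases le_total i j with h | h
  · exact key _ rfl (fun k hk e1 e2 => hns ⟨k, hk, e1, by simpa using e2⟩) i j h hj ei
      (by simpa using ej)
  · exact key _ rfl (fun k hk e1 e2 => hsn ⟨k, hk, e1, by simpa using e2⟩) j i h hi ej
      (by simpa using ei)

theorem exists_fullRow (hd : IsDirSeq d) (h1 : Occurs n d (1, 0)) (h2 : Occurs n d (-1, 0)) :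
    ∃ y, FullRow n d y := by
  obtain ⟨y, hy⟩ := exists_fullCol hd.swap h1.swap h2.swap
  exact ⟨y, fullCol_swap.1 hy⟩

end Extremal

/-! ### Grid connectedness -/

section Grid

variable {S : Set (ℤ × ℤ)}

/-- Adjacency of points of `S` in the grid. -/
def GridAdj (S : Set (ℤ × ℤ)) (u v : ℤ × ℤ) : Prop :=
  u ∈ S ∧ v ∈ S ∧ |v.1 - u.1| + |v.2 - u.2| = 1

/-- `u` and `v` are joined by a path in `S`. -/
def GridJoined (S : Set (ℤ × ℤ)) : ℤ × ℤ → ℤ × ℤ → Prop := Relation.ReflTransGen (GridAdj S)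

lemma GridJoined.symm {u v : ℤ × ℤ} (h : GridJoined S u v) : GridJoined S v u := by
  induction h with
  | refl => exact .refl
  | @tail b c _ hbc ih =>
    exact ih.head ⟨hbc.2.1, hbc.1, by rw [abs_sub_comm, abs_sub_comm b.2]; exact hbc.2.2⟩

lemma gridConnected_of_joined (h : ∀ u ∈ S, ∀ v ∈ S, GridJoined S u v) : GridConnected S := by
  intro u hu v hv
  induction h u hu v hv with
  | refl => exact ⟨0, fun _ => u, rfl, rfl, fun _ _ => hu, fun i hi => absurd hi (by omega)⟩
  | @tail b c _ hbc ih =>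
    obtain ⟨n, f, h0, hn, hS, hadj⟩ := ih hbc.1
    refine ⟨n + 1, fun i => if i ≤ n then f i else c, by simpa using h0, by simp, fun i _ => ?_,
      fun i hi => ?_⟩
    · dsimp only
      split_ifs with hi
      exacts [hS i hi, hbc.2.1]
    · rcases Nat.lt_or_ge i n with hlt | hge
      · simpa [hlt.le, show i + 1 ≤ n from hlt] using hadj i hlt
      · obtain rfl : i = n := by omega
        simpa [hn] using hbc.2.2

lemma gridConnected_of_center {c : ℤ × ℤ} (h : ∀ u ∈ S, GridJoined S u c) : GridConnected S :=
  gridConnected_of_joined fun u hu v hv => (h u hu).trans (h v hv).symm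

lemma gridJoined_row_of_le {x x' y : ℤ} (hx : x ≤ x')
    (h : ∀ t, x ≤ t → t ≤ x' → (t, y) ∈ S) : GridJoined S (x, y) (x', y) := by
  induction x', hx using Int.leInduction with
  | base => exact .refl
  | succ k hk ih =>
    exact (ih fun t h1 h2 => h t h1 (by omega)).tail
      ⟨h k hk (by omega), h _ (by omega) le_rfl, by simp⟩

lemma gridJoined_row {x x' y : ℤ} (h : ∀ t, min x x' ≤ t → t ≤ max x x' → (t, y) ∈ S) :
    GridJoined S (x, y) (x', y) := by
  rcases le_total x x' with hx | hx
  · exact gridJoined_row_of_le hx fun t h1 h2 => h t (by omega) (by omega)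
  · exact (gridJoined_row_of_le hx fun t h1 h2 => h t (by omega) (by omega)).symm

lemma gridJoined_col_of_le {x y y' : ℤ} (hy : y ≤ y')
    (h : ∀ t, y ≤ t → t ≤ y' → (x, t) ∈ S) : GridJoined S (x, y) (x, y') := by
  induction y', hy using Int.leInduction with
  | base => exact .refl
  | succ k hk ih =>
    exact (ih fun t h1 h2 => h t h1 (by omega)).tail
      ⟨h k hk (by omega), h _ (by omega) le_rfl, by simp⟩

lemma gridJoined_col {x y y' : ℤ} (h : ∀ t, min y y' ≤ t → t ≤ max y y' → (x, t) ∈ S) :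
    GridJoined S (x, y) (x, y') := by
  rcases le_total y y' with hy | hy
  · exact gridJoined_col_of_le hy fun t h1 h2 => h t (by omega) (by omega)
  · exact (gridJoined_col_of_le hy fun t h1 h2 => h t (by omega) (by omega)).symm

end Grid

section Connected

variable {n : ℕ} {d p : ℕ → ℤ × ℤ}

lemma Realizes.fst_mono (hd : IsDirSeq d) (h : Realizes n d p) (hW : ¬ Occurs n d (-1, 0))
    {i j : ℕ} (hij : i ≤ j) (hj : j ≤ n + 1) : (p i).1 ≤ (p j).1 := by
  induction j, hij using Nat.le_induction with
  | base => exact le_rfl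
  | succ k _ ih =>
    have a := ih (by omega)
    have b : d k ≠ (-1, 0) := fun e => hW ⟨k, by omega, e⟩
    have c := h.step_cases hd (show k ≤ n by omega)
    simp only [b, false_and, false_or] at c
    omega

lemma Realizes.snd_mono (hd : IsDirSeq d) (h : Realizes n d p) (hS : ¬ Occurs n d (0, -1))
    {i j : ℕ} (hij : i ≤ j) (hj : j ≤ n + 1) : (p i).2 ≤ (p j).2 :=
  h.swap.fst_mono hd.swap (fun ho => hS (by simpa using ho.swap)) hij hj

lemma fst_pos_of_mem_reach (hd : IsDirSeq d) (h0 : d 0 = (1, 0)) (hW : ¬ Occurs n d (-1, 0))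
    {z : ℤ × ℤ} (hz : z ∈ reach n d) : 0 < z.1 := by
  obtain ⟨p, h, rfl⟩ := hz
  have a := h.fst_mono hd hW (show 1 ≤ n + 1 by omega) le_rfl
  have b := h.step_cases hd (Nat.zero_le n)
  simp [h0, h.zero] at b
  omega

lemma snd_sign_of_not_south (hd : IsDirSeq d) (h0 : d 0 = (1, 0)) (hS : ¬ Occurs n d (0, -1)) :
    (∀ z ∈ reach n d, z.2 = 0) ∨ ∀ z ∈ reach n d, 0 < z.2 := by
  rcases Nat.eq_zero_or_pos n with rfl | hn
  · left
    rintro _ ⟨p, h, rfl⟩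
    have b := h.step_cases hd le_rfl
    simp [h0, h.zero] at b
    simp [b]
  · right
    rintro _ ⟨p, h, rfl⟩
    have a := h.snd_mono hd hS (show 2 ≤ n + 1 by omega) le_rfl
    have a' := h.snd_mono hd hS (show 0 ≤ 1 by omega) (by omega)
    have b := h.step_cases hd hn
    have c := hd.perp_cases 0
    have e : d 1 ≠ (0, -1) := fun e => hS ⟨1, hn, e⟩
    rw [h.zero] at a'
    simp [h0, e] at c
    simp [c] at b
    dsimp only at a'
    omega

lemma snd_sign (hd : IsDirSeq d) (h0 : d 0 = (1, 0))
    (hNS : ¬ Occurs n d (0, 1) ∨ ¬ Occurs n d (0, -1)) :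
    (∀ z ∈ reach n d, z.2 = 0) ∨ (∀ z ∈ reach n d, 0 < z.2) ∨ ∀ z ∈ reach n d, z.2 < 0 := by
  rcases hNS with hN | hS
  · rcases snd_sign_of_not_south hd.reflectY (by simp [h0, reflY])
      (fun ho => hN (by simpa [reflY] using ho.reflectY)) with h | h
    · exact .inl fun z hz => by simpa using h _ (reflY_mem_reach hz)
    · exact .inr (.inr fun z hz => by simpa using h _ (reflY_mem_reach hz))
  · exact (snd_sign_of_not_south hd h0 hS).imp id .inl

lemma not_fullCol_zero (hd : IsDirSeq d) : ¬ FullCol n d 0 := fun h => zero_notMem_reach hd (h 0)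

lemma not_fullRow_zero (hd : IsDirSeq d) : ¬ FullRow n d 0 := fun h => zero_notMem_reach hd (h 0)

lemma FullCol.of_between (hd : IsDirSeq d) {x t : ℤ} (h : FullCol n d t) (h1 : min x 0 ≤ t)
    (h2 : t ≤ max x 0) : FullCol n d x := by
  have : t ≠ 0 := by rintro rfl; exact not_fullCol_zero hd h
  exact h.outward hd (by omega)

lemma FullRow.of_between (hd : IsDirSeq d) {y t : ℤ} (h : FullRow n d t) (h1 : min y 0 ≤ t)
    (h2 : t ≤ max y 0) : FullRow n d y := by
  have : t ≠ 0 := by rintro rfl; exact not_fullRow_zero hd h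
  exact h.outward hd (by omega)

lemma gridConnected_compl_of_full (hd : IsDirSeq d)
    (h : ∀ z ∈ reach n d, FullRow n d z.2 ∨ FullCol n d z.1) : GridConnected (reach n d)ᶜ := by
  refine gridConnected_of_center (c := (0, 0)) fun z hz => ?_
  have hrow : ¬ FullRow n d z.2 := fun hr => hz (hr z.1)
  have hcol : ¬ FullCol n d z.1 := fun hc => hz (hc z.2)
  refine Relation.ReflTransGen.trans (b := (0, z.2)) (gridJoined_row fun t h1 h2 ht => ?_)
    (gridJoined_col fun t h1 h2 ht => ?_)
  · exact (h _ ht).elim hrow fun hc => hcol (hc.of_between hd h1 h2)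
  · exact (h _ ht).elim (fun hr => hrow (hr.of_between hd h1 h2)) (not_fullCol_zero hd)

lemma gridConnected_of_fullRow_fullCol {x y : ℤ} (hx : FullCol n d x) (hy : FullRow n d y)
    (h : ∀ z ∈ reach n d, FullRow n d z.2 ∨ FullCol n d z.1) : GridConnected (reach n d) := by
  refine gridConnected_of_center (c := (x, y)) fun z hz => ?_
  rcases h z hz with hr | hc
  · exact Relation.ReflTransGen.trans (b := (x, z.2)) (gridJoined_row fun t _ _ => hr t)
      (gridJoined_col fun t _ _ => hx t)
  · exact Relation.ReflTransGen.trans (b := (z.1, y)) (gridJoined_col fun t _ _ => hc t)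
      (gridJoined_row fun t _ _ => hy t)

lemma gridConnected_of_fullCol (h : ∀ z ∈ reach n d, FullCol n d z.1)
    (hconv : ∀ x t x', FullCol n d x → FullCol n d x' → min x x' ≤ t → t ≤ max x x' →
      FullCol n d t) : GridConnected (reach n d) :=
  gridConnected_of_joined fun u hu v hv =>
    Relation.ReflTransGen.trans (b := (u.1, v.2)) (gridJoined_col fun t _ _ => h u hu t)
      (gridJoined_row fun t h1 h2 => hconv _ t _ (h u hu) (h v hv) h1 h2 v.2)

lemma gridConnected_of_fullRow (h : ∀ z ∈ reach n d, FullRow n d z.2)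
    (hconv : ∀ y t y', FullRow n d y → FullRow n d y' → min y y' ≤ t → t ≤ max y y' →
      FullRow n d t) : GridConnected (reach n d) :=
  gridConnected_of_joined fun u hu v hv =>
    Relation.ReflTransGen.trans (b := (v.1, u.2)) (gridJoined_row fun t _ _ => h u hu t)
      (gridJoined_col fun t h1 h2 => hconv _ t _ (h u hu) (h v hv) h1 h2 v.1)

lemma gridConnected_reach_of_monotone (hd : IsDirSeq d) (h0 : d 0 = (1, 0))
    (hW : ¬ Occurs n d (-1, 0)) (hNS : ¬ Occurs n d (0, 1) ∨ ¬ Occurs n d (0, -1)) :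
    GridConnected (reach n d) ∧ GridConnected (reach n d)ᶜ := by
  have hpos : ∀ z ∈ reach n d, 0 < z.1 := fun z hz => fst_pos_of_mem_reach hd h0 hW hz
  have hout : ∀ x x' y, (x, y) ∈ reach n d → x ≤ x' → (x', y) ∈ reach n d := fun x x' y hz hx =>
    mem_reach_of_outward hd hz (.inl ⟨hpos _ hz, hx⟩)
  constructor
  · refine gridConnected_of_joined fun u hu v hv => ?_
    refine Relation.ReflTransGen.trans (b := (max u.1 v.1, u.2))
      (gridJoined_row fun t h1 h2 => hout u.1 t u.2 hu (by omega))
      (Relation.ReflTransGen.trans (b := (max u.1 v.1, v.2)) (gridJoined_col fun t h1 h2 => ?_)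
      (gridJoined_row fun t h1 h2 => hout v.1 t v.2 hv (by omega)))
    have hu' := hout u.1 (max u.1 v.1) u.2 hu (le_max_left _ _)
    have hv' := hout v.1 (max u.1 v.1) v.2 hv (le_max_right _ _)
    rcases snd_sign hd h0 hNS with h | h | h <;> have hu2 := h u hu <;> have hv2 := h v hv
    · rwa [show t = u.2 by omega]
    · rcases lt_or_ge t u.2 with ht | ht
      · exact mem_reach_of_outward_vertical hd hv' (by omega)
      · exact mem_reach_of_outward_vertical hd hu' (by omega)
    · rcases lt_or_ge u.2 t with ht | ht
      · exact mem_reach_of_outward_vertical hd hv' (by omega)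
      · exact mem_reach_of_outward_vertical hd hu' (by omega)
  · refine gridConnected_of_center (c := (0, 0)) fun z hz => ?_
    refine Relation.ReflTransGen.trans (b := (0, z.2)) (gridJoined_row fun t h1 h2 ht => ?_)
      (gridJoined_col fun t h1 h2 ht => ?_)
    · have := hpos _ ht
      exact hz (hout t z.1 z.2 ht (by dsimp only at this; omega))
    · exact (hpos _ ht).ne' rfl

/-- The set of points reachable with prescribed directions and its complement are connected. -/
theorem gridConnected_reach (hd : IsDirSeq d) (h0 : d 0 = (1, 0)) :
    GridConnected (reach n d) ∧ GridConnected (reach n d)ᶜ := by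
  have hE : Occurs n d (1, 0) := ⟨0, Nat.zero_le n, h0⟩
  by_cases hW : Occurs n d (-1, 0) <;>
    by_cases hNS : ¬ Occurs n d (0, 1) ∨ ¬ Occurs n d (0, -1)
  · have hsign := snd_sign hd h0 hNS
    have hcol : ∀ x, ¬ FullCol n d x := fun x hx => by
      rcases hsign with h | h | h
      · exact absurd (h _ (hx 1)) one_ne_zero
      · exact absurd (h _ (hx (-1))) (by simp)
      · exact absurd (h _ (hx 1)) (by simp)
    have hfull : ∀ z ∈ reach n d, FullRow n d z.2 := fun z hz => by
      rcases fullRow_or_fullCol_of_mem_reach hd hz with h | h | h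
      exacts [h, absurd h (hcol _), absurd h (by tauto)]
    refine ⟨gridConnected_of_fullRow hfull fun y t y' hy hy' h1 h2 => ?_,
      gridConnected_compl_of_full hd fun z hz => .inl (hfull z hz)⟩
    rcases hsign with h | h | h <;> have a := h _ (hy 0) <;> have b := h _ (hy' 0) <;>
      dsimp only at a b
    · rwa [show t = y by omega]
    · rcases lt_or_ge t y with ht | ht
      · exact hy'.outward hd (by omega)
      · exact hy.outward hd (by omega)
    · rcases lt_or_ge y t with ht | ht
      · exact hy'.outward hd (by omega)
      · exact hy.outward hd (by omega)
  · push Not at hNS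
    have hfull : ∀ z ∈ reach n d, FullRow n d z.2 ∨ FullCol n d z.1 := fun z hz => by
      rcases fullRow_or_fullCol_of_mem_reach hd hz with h | h | h
      exacts [.inl h, .inr h, absurd h (by tauto)]
    obtain ⟨x, hx⟩ := exists_fullCol hd hNS.1 hNS.2
    obtain ⟨y, hy⟩ := exists_fullRow hd hE hW
    exact ⟨gridConnected_of_fullRow_fullCol hx hy hfull, gridConnected_compl_of_full hd hfull⟩
  · exact gridConnected_reach_of_monotone hd h0 hW hNS
  · have hpos : ∀ z ∈ reach n d, 0 < z.1 := fun z hz => fst_pos_of_mem_reach hd h0 hW hz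
    have hfull : ∀ z ∈ reach n d, FullCol n d z.1 := fun z hz => by
      rcases fullRow_or_fullCol_of_mem_reach hd hz with h | h | h
      exacts [absurd (hpos _ (h 0)) (lt_irrefl _), h, absurd h (by tauto)]
    refine ⟨gridConnected_of_fullCol hfull fun x t x' hx hx' h1 h2 => ?_,
      gridConnected_compl_of_full hd fun z hz => .inr (hfull z hz)⟩
    have a := hpos _ (hx 0)
    have b := hpos _ (hx' 0)
    dsimp only at a b
    rcases lt_or_ge t x with ht | ht
    · exact hx'.outward hd (by omega)
    · exact hx.outward hd (by omega)

end Connected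

/-! ### Turn sequences -/

/-- The direction of the `i`-th segment of a chain realizing `σ`. -/
def turnDir (σ : List Turn) : ℕ → ℤ × ℤ
  | 0 => (1, 0)
  | i + 1 => (if σ.getD i Turn.L = Turn.L then rotCCW else rotCW) (turnDir σ i)

lemma isDirSeq_turnDir (σ : List Turn) : IsDirSeq (turnDir σ) := by
  have unit : ∀ i, turnDir σ i = (1, 0) ∨ turnDir σ i = (-1, 0) ∨ turnDir σ i = (0, 1) ∨
      turnDir σ i = (0, -1) := by
    intro i
    induction i with
    | zero => exact .inl rfl
    | succ i ih =>
      rw [turnDir]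
      split_ifs <;> rcases ih with e | e | e | e <;> simp [e, rotCCW, rotCW]
  refine ⟨unit, fun i => ?_⟩
  rw [turnDir]
  split_ifs <;> rcases unit i with e | e | e | e <;> simp [e, rotCCW, rotCW]

lemma unitDir_eq {u v w : ℤ × ℤ}
    (hw : w = (1, 0) ∨ w = (-1, 0) ∨ w = (0, 1) ∨ w = (0, -1)) :
    unitDir u v = w ↔ ∃ t : ℤ, 0 < t ∧ v.1 = u.1 + t * w.1 ∧ v.2 = u.2 + t * w.2 := by
  simp only [unitDir, Prod.ext_iff]
  constructor
  · rintro ⟨h1, h2⟩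
    refine ⟨|v.1 - u.1| + |v.2 - u.2|, ?_⟩
    rcases hw with rfl | rfl | rfl | rfl <;>
      simp only [Int.sign_eq_one_iff_pos, Int.sign_eq_neg_one_iff_neg, Int.sign_eq_zero_iff_zero]
        at h1 h2 <;> simp only [mul_one, mul_zero, mul_neg] <;> grind
  · rintro ⟨t, ht, h1, h2⟩
    rcases hw with rfl | rfl | rfl | rfl <;>
      simp only [Int.sign_eq_one_iff_pos, Int.sign_eq_neg_one_iff_neg, Int.sign_eq_zero_iff_zero]
        <;> dsimp only at h1 h2 <;> omega

lemma Chain.unitDir_eq_turnDir {σ : List Turn} (C : Chain σ) {i : ℕ} (hi : i ≤ σ.length) :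
    unitDir (C.pts i) (C.pts (i + 1)) = turnDir σ i := by
  induction i with
  | zero =>
    obtain ⟨t, ht, e⟩ := C.first_seg
    exact (unitDir_eq (.inl rfl)).2 ⟨t, ht, by simp [C.start_eq, e], by simp [C.start_eq, e]⟩
  | succ i ih =>
    rw [C.turns i hi, ih (by omega), turnDir, List.get_eq_getElem, List.getD_eq_getElem]

lemma Chain.realizes {σ : List Turn} (C : Chain σ) :
    Realizes σ.length (turnDir σ) C.pts where
  zero := C.start_eq
  step i hi := (unitDir_eq ((isDirSeq_turnDir σ).unit i)).1 (C.unitDir_eq_turnDir hi)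
  disj i j hij hj z h1 h2 := by
    have := C.simple_nonadj i j hij hj
    exact (this ▸ ⟨h1, h2⟩ : z ∈ (∅ : Set (ℤ × ℤ)))

/-- The chain of a realization of the directions prescribed by `σ`. -/
def Realizes.toChain {σ : List Turn} {p : ℕ → ℤ × ℤ} (h : Realizes σ.length (turnDir σ) p) :
    Chain σ where
  pts := p
  start_eq := h.zero
  first_seg := by
    obtain ⟨t, ht, h1, h2⟩ := h.step 0 (Nat.zero_le _)
    exact ⟨t, ht, Prod.ext (by simpa [h.zero, turnDir] using h1)
      (by simpa [h.zero, turnDir] using h2)⟩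
  axis_parallel i hi := by
    have := h.step_cases (isDirSeq_turnDir σ) hi
    omega
  turns i hi := by
    have key := fun j hj => (unitDir_eq ((isDirSeq_turnDir σ).unit j)).2 (h.step j hj)
    rw [key (i + 1) hi, key i hi.le, turnDir, List.get_eq_getElem, List.getD_eq_getElem]
  simple_adj i hi := by
    ext z
    refine ⟨fun ⟨h1, h2⟩ => h.eq_of_mem_of_mem_succ (isDirSeq_turnDir σ) hi h1 h2, ?_⟩
    rintro rfl
    exact ⟨right_mem_segSet _ _, left_mem_segSet _ _⟩
  simple_nonadj i j hij hj :=
    Set.eq_empty_iff_forall_notMem.2 fun z hz => h.disj i j hij hj z hz.1 hz.2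

lemma reachSet_eq_reach (σ : List Turn) : ReachSet σ = reach σ.length (turnDir σ) := by
  ext z
  exact ⟨fun ⟨C, e⟩ => ⟨C.pts, C.realizes, e⟩, fun ⟨p, h, e⟩ => ⟨h.toChain, e⟩⟩

/-- **Connectedness.** For every turn sequence `σ`, both the reachable set `A(σ)`
and its complement are connected in the grid-path sense. -/
theorem reachable_set_connected (σ : List Turn) :
    GridConnected (ReachSet σ) ∧ GridConnected (ReachSet σ)ᶜ := by
  rw [reachSet_eq_reach]
  exact gridConnected_reach (isDirSeq_turnDir σ) rfl
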